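/- arXiv:2507.18211 — 2 statements merged into one kernel-verified Lean document; each statement's English description precedes it below -/
import Mathlib

section
/- Let Ω ⊆ ℝ³ be a bounded convex open set, α ≥ 0, β₁ ∈ ℝ, −3 < γ ≤ 1, 2 ≤ p < ∞, B₀ > 0, and let ν be the collision frequency. Let k : ℝ³ × ℝ³ → ℝ be a measurable kernel such that the conjugated kernel k_α(v, v_*) := e^{α|v|²} k(v, v_*) e^{−α|v_*|²} satisfies, for some constants C₀ > 0 and α₁, α₂, α₃ > 0 and all v ≠ v_*, both |k_α(v, v_*)| ≤ C₀ w_γ(|v − v_*|) (1 + |v| + |v_*|)^{γ−1} e^{−α₁ |v − v_*|²} e^{−α₃ ((v − v_*)·v/|v − v_*| − α₂ |v − v_*|)²} and |k_α(v, v_*)| ≤ C₀ w_γ(|v − v_*|) (1 + |v| + |v_*|)^{γ−1} e^{−α₁ |v − v_*|²} e^{−α₃ ((v − v_*)·v_*/|v − v_*| + α₂ |v − v_*|)²}. Define K h(x, v) = ∫_{ℝ³} k(v, v_*) h(x, v_*) dv_*. Then there exists a constant C > 0 such that for every measurable h : Ω × ℝ³ → ℝ, ∫_Ω ∫_{ℝ³}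 |S_Ω K h(x, v)|^p e^{pα|v|²} (1 + |v|)^{p(β₁ + 3 − γ)} dv dx ≤ C ∫_Ω ∫_{ℝ³} |h(x, v)|^p e^{pα|v|²} (1 + |v|)^{pβ₁} dv dx. -/
open MeasureTheory Real Set
open scoped ENNReal RealInnerProductSpace

noncomputable section

/-- `ℝ³` as a Euclidean space. -/
abbrev E3 : Type := EuclideanSpace ℝ (Fin 3)

/-- The collision frequency `ν(v) = B₀ π ∫_{ℝ³} |v − w|^γ e^{−|w|²} dw`. -/
def nu (B₀ γ : ℝ) (v : E3) : ℝ :=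
  B₀ * π * ∫ w : E3, ‖v - w‖ ^ γ * Real.exp (-‖w‖ ^ 2)

/-- The backward exit time `τ₋(x, v) = inf {t > 0 : x − t v ∉ Ω}` (equal to `+∞` if
no such `t` exists). -/
def tauMinus (Ω : Set E3) (x v : E3) : ℝ≥0∞ :=
  sInf (ENNReal.ofReal '' {t : ℝ | 0 < t ∧ x - t • v ∉ Ω})

/-- The interval of integration `(0, τ₋(x,v))`. -/
def tauItv (Ω : Set E3) (x v : E3) : Set ℝ :=
  {t : ℝ | 0 < t ∧ ENNReal.ofReal t < tauMinus Ω x v}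

/-- The singular weight `w_γ`. -/
def wGamma (γ r : ℝ) : ℝ :=
  if -1 < γ then 1 / r
  else if γ = -1 then (|Real.log r| + 1) / r
  else 1 / r ^ |γ|

/-- The integral operator `K h(x,v) = ∫ k(v,v_*) h(x,v_*) dv_*`. -/
def Kop (k : E3 → E3 → ℝ) (h : E3 → E3 → ℝ) (x v : E3) : ℝ :=
  ∫ vs : E3, k v vs * h x vs

/-- The operator `S_Ω K h(x,v) = ∫₀^{τ₋(x,v)} e^{−ν(v)t} (K h)(x − tv, v) dt`. -/
def SOmK (Ω : Set E3) (B₀ γ : ℝ) (k : E3 → E3 → ℝ) (h : E3 → E3 → ℝ) (x v : E3) : ℝ :=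
  ∫ t in tauItv Ω x v, Real.exp (-(nu B₀ γ v) * t) * Kop k h (x - t • v) v

theorem lintegral_plane_shifted_radial_le (g : ℝ → ℝ≥0∞) (hg : Measurable g) (z : ℝ) :
    ∫⁻ w : ℝ × ℝ, g (√(z ^ 2 + (w.1 ^ 2 + w.2 ^ 2))) ≤
      ENNReal.ofReal (2 * π) * ∫⁻ r in Ioi |z|, ENNReal.ofReal r * g r := by
  rw [← lintegral_comp_polarCoord_symm, polarCoord_target]
  have hpos : ∀ ρ ∈ Ioi (0 : ℝ), 0 < z ^ 2 + ρ ^ 2 := fun ρ hρ => by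
    have : 0 < ρ := hρ
    positivity
  have hint : ∀ p : ℝ × ℝ, ENNReal.ofReal p.1 •
      g (√(z ^ 2 + ((polarCoord.symm p).1 ^ 2 + (polarCoord.symm p).2 ^ 2))) =
        ENNReal.ofReal p.1 * g (√(z ^ 2 + p.1 ^ 2)) := fun p => by
    have : (polarCoord.symm p).1 ^ 2 + (polarCoord.symm p).2 ^ 2 = p.1 ^ 2 := by
      simp only [polarCoord_symm_apply]
      linear_combination p.1 ^ 2 * Real.sin_sq_add_cos_sq p.2
    rw [this, smul_eq_mul]
  simp_rw [hint]
  rw [Measure.volume_eq_prod, ← Measure.prod_restrict, lintegral_prod _ (by fun_prop)]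
  simp only [lintegral_const, Measure.restrict_apply MeasurableSet.univ, univ_inter,
    Real.volume_Ioo, sub_neg_eq_add]
  rw [lintegral_mul_const _ (by fun_prop), mul_comm, two_mul]
  refine mul_le_mul_right ?_ _
  have himg := lintegral_image_eq_lintegral_abs_deriv_mul (s := Ioi (0 : ℝ))
    (f := fun ρ => √(z ^ 2 + ρ ^ 2)) (f' := fun ρ => (2 * ρ) / (2 * √(z ^ 2 + ρ ^ 2)))
    measurableSet_Ioi
    (fun ρ hρ => by
      have h1 : HasDerivAt (fun ρ : ℝ => z ^ 2 + ρ ^ 2) (2 * ρ) ρ := by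
        simpa using ((hasDerivAt_pow 2 ρ).const_add (z ^ 2))
      exact (h1.sqrt (hpos ρ hρ).ne').hasDerivWithinAt)
    (fun a ha b hb hab => by
      have ha' : 0 < a := ha
      have hb' : 0 < b := hb
      have h2 := (Real.sqrt_inj (hpos a ha).le (hpos b hb).le).1 hab
      nlinarith)
    (fun r => ENNReal.ofReal r * g r)
  calc ∫⁻ ρ in Ioi (0 : ℝ), ENNReal.ofReal ρ * g (√(z ^ 2 + ρ ^ 2))
      = ∫⁻ r in (fun ρ => √(z ^ 2 + ρ ^ 2)) '' Ioi (0 : ℝ), ENNReal.ofReal r * g r := by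
        rw [himg]
        refine setLIntegral_congr_fun measurableSet_Ioi fun ρ hρ => ?_
        have hρ' : 0 < ρ := hρ
        have hs := Real.sqrt_pos.2 (hpos ρ hρ)
        rw [← mul_assoc, ← ENNReal.ofReal_mul (abs_nonneg _), abs_of_nonneg (by positivity)]
        congr 2
        field_simp
    _ ≤ _ := by
        refine lintegral_mono_set ?_
        rintro _ ⟨ρ, hρ, rfl⟩
        have hρ' : 0 < ρ := hρ
        simp only [mem_Ioi]
        rw [← Real.sqrt_sq_eq_abs]
        exact Real.sqrt_lt_sqrt (sq_nonneg z) (by nlinarith)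

theorem lintegral_norm_coord_le (H : ℝ × ℝ → ℝ≥0∞) (hH : Measurable H) :
    ∫⁻ y : E3, H (‖y‖, y 0) ≤ ENNReal.ofReal (2 * π) *
      ∫⁻ r in Ioi (0 : ℝ), ENNReal.ofReal r * ∫⁻ z in Ioo (-r) r, H (r, z) := by
  have e1 : ∫⁻ y : E3, H (‖y‖, y 0) =
      ∫⁻ q : ℝ × (ℝ × ℝ), H (√(q.1 ^ 2 + (q.2.1 ^ 2 + q.2.2 ^ 2)), q.1) := by
    have m1 := PiLp.volume_preserving_ofLp (Fin 3)
    have m2 := volume_preserving_piFinSuccAbove (fun _ : Fin 3 => ℝ) 0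
    have m3 := (MeasurePreserving.id (volume : Measure ℝ)).prod (volume_preserving_finTwoArrow ℝ)
    have m := (m3.comp m2).comp m1
    have := m.lintegral_comp (f := fun q : ℝ × (ℝ × ℝ) =>
      H (√(q.1 ^ 2 + (q.2.1 ^ 2 + q.2.2 ^ 2)), q.1)) (by fun_prop)
    refine Eq.trans (lintegral_congr fun y => ?_) this
    rw [EuclideanSpace.norm_eq]
    simp [Fin.sum_univ_succ, MeasurableEquiv.piFinSuccAbove, MeasurableEquiv.finTwoArrow,
      Fin.insertNthEquiv]
    rfl
  rw [e1, Measure.volume_eq_prod, lintegral_prod _ (by fun_prop)]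
  calc ∫⁻ z : ℝ, ∫⁻ w : ℝ × ℝ, H (√(z ^ 2 + (w.1 ^ 2 + w.2 ^ 2)), z)
      ≤ ∫⁻ z : ℝ, ENNReal.ofReal (2 * π) * ∫⁻ r in Ioi |z|, ENNReal.ofReal r * H (r, z) :=
        lintegral_mono fun z =>
          lintegral_plane_shifted_radial_le (fun r => H (r, z)) (by fun_prop) z
    _ = ENNReal.ofReal (2 * π) * ∫⁻ z : ℝ, ∫⁻ r in Ioi |z|, ENNReal.ofReal r * H (r, z) :=
        lintegral_const_mul' _ _ ENNReal.ofReal_ne_top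
    _ = ENNReal.ofReal (2 * π) * ∫⁻ z : ℝ, ∫⁻ r : ℝ,
          {q : ℝ × ℝ | |q.1| < q.2}.indicator
            (fun q => ENNReal.ofReal q.2 * H (q.2, q.1)) (z, r) := by
        congr 1
        refine lintegral_congr fun z => ?_
        rw [← lintegral_indicator measurableSet_Ioi]
        rfl
    _ = ENNReal.ofReal (2 * π) * ∫⁻ r : ℝ, ∫⁻ z : ℝ,
          {q : ℝ × ℝ | |q.1| < q.2}.indicator
            (fun q => ENNReal.ofReal q.2 * H (q.2, q.1)) (z, r) := by
        rw [lintegral_lintegral_swap]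
        refine Measurable.aemeasurable (Measurable.indicator (by fun_prop) ?_)
        exact measurableSet_lt (by fun_prop) (by fun_prop)
    _ ≤ _ := by
        refine mul_le_mul_right ?_ _
        rw [← lintegral_indicator measurableSet_Ioi]
        refine lintegral_mono fun r => ?_
        by_cases hr : 0 < r
        · rw [indicator_of_mem (show r ∈ Ioi (0 : ℝ) from hr),
            ← lintegral_const_mul _ (by fun_prop), ← lintegral_indicator measurableSet_Ioo]
          refine lintegral_mono fun z => ?_
          by_cases hz : |z| < r
          · rw [indicator_of_mem (show (z, r) ∈ {q : ℝ × ℝ | |q.1| < q.2} from hz),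
              indicator_of_mem (show z ∈ Ioo (-r) r from abs_lt.1 hz)]
          · rw [indicator_of_notMem (show (z, r) ∉ {q : ℝ × ℝ | |q.1| < q.2} from hz)]
            exact zero_le
        · rw [indicator_of_notMem (show r ∉ Ioi (0 : ℝ) from hr)]
          refine le_of_eq ((lintegral_congr fun z => ?_).trans lintegral_zero)
          exact indicator_of_notMem (show (z, r) ∉ {q : ℝ × ℝ | |q.1| < q.2} from
            fun h => hr ((abs_nonneg z).trans_lt h)) _

theorem lintegral_Ioo_exp_neg_sq_affine_le {a : ℝ} (ha : 0 < a) {R r : ℝ} (hR : 0 ≤ R)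
    (hr : 0 < r) (b : ℝ) :
    ENNReal.ofReal (1 + R) * ∫⁻ z in Ioo (-r) r,
      ENNReal.ofReal (Real.exp (-a * (R * z / r - b) ^ 2)) ≤
        ENNReal.ofReal (4 + 2 * √(π / a)) * ENNReal.ofReal r := by
  rw [← ENNReal.ofReal_mul (by positivity)]
  have hG0 : 0 ≤ √(π / a) := Real.sqrt_nonneg _
  rcases le_total R 1 with h1 | h1
  · calc _ ≤ ENNReal.ofReal (1 + R) * ∫⁻ z in Ioo (-r) r, 1 := by
          gcongr with z
          rw [ENNReal.ofReal_le_one, Real.exp_le_one_iff]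
          have := mul_nonneg ha.le (sq_nonneg (R * z / r - b))
          linarith
      _ = ENNReal.ofReal ((1 + R) * (2 * r)) := by
          rw [setLIntegral_one, Real.volume_Ioo, ENNReal.ofReal_mul (by positivity)]
          ring_nf
      _ ≤ _ := by
          apply ENNReal.ofReal_le_ofReal
          nlinarith [mul_nonneg hG0 hr.le]
  · have hR0 : 0 < R := by linarith
    have key : ∫⁻ z : ℝ, ENNReal.ofReal (Real.exp (-a * (R * z / r - b) ^ 2)) =
        ENNReal.ofReal (√(π / a) * (r / R)) := by
      have hi : Integrable (fun z : ℝ => Real.exp (-a * (R / r * z - b) ^ 2)) :=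
        ((integrable_exp_neg_mul_sq ha).comp_sub_right b).comp_mul_left' (by positivity)
      have hc : ∀ z : ℝ, R * z / r = R / r * z := fun z => by ring
      simp_rw [hc]
      rw [← ofReal_integral_eq_lintegral_ofReal hi (ae_of_all _ fun z => (Real.exp_pos _).le)]
      congr 1
      rw [Measure.integral_comp_mul_left (fun z => Real.exp (-a * (z - b) ^ 2)) (R / r),
        integral_sub_right_eq_self (fun z => Real.exp (-a * z ^ 2)) b, integral_gaussian,
        abs_of_pos (by positivity), smul_eq_mul, inv_div, mul_comm]
    calc _ ≤ ENNReal.ofReal (1 + R) * ∫⁻ z : ℝ,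
            ENNReal.ofReal (Real.exp (-a * (R * z / r - b) ^ 2)) := by
          gcongr
          exact Measure.restrict_le_self
      _ = ENNReal.ofReal ((1 + R) * (√(π / a) * (r / R))) := by
          rw [key, ENNReal.ofReal_mul (p := 1 + R) (by positivity)]
      _ ≤ _ := by
          apply ENNReal.ofReal_le_ofReal
          have : (1 + R) * (√(π / a) * (r / R)) = √(π / a) * r * ((1 + R) / R) := by ring
          rw [this]
          have h2 : (1 + R) / R ≤ 2 := by rw [div_le_iff₀ hR0]; linarith
          nlinarith [mul_le_mul_of_nonneg_left h2 (mul_nonneg hG0 hr.le)]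

theorem exists_orthonormalBasis_eq_norm_smul (v : E3) :
    ∃ b : OrthonormalBasis (Fin 3) ℝ E3, v = ‖v‖ • b 0 := by
  obtain ⟨e, he, hv⟩ : ∃ e : E3, ‖e‖ = 1 ∧ v = ‖v‖ • e := by
    by_cases h : v = 0
    · exact ⟨EuclideanSpace.single 0 1, by simp, by simp [h]⟩
    · refine ⟨‖v‖⁻¹ • v, norm_smul_inv_norm (𝕜 := ℝ) h, ?_⟩
      rw [smul_smul, mul_inv_cancel₀ (norm_ne_zero_iff.2 h), one_smul]
  have ho : Orthonormal ℝ (({0} : Set (Fin 3)).domRestrict fun _ => e) := by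
    refine ⟨fun i => he, fun i j hij => (hij ?_).elim⟩
    exact Subsingleton.elim i j
  obtain ⟨b, hb⟩ := ho.exists_orthonormalBasis_extension_of_card_eq (by simp)
  exact ⟨b, by rw [hb 0 rfl]; exact hv⟩

theorem lintegral_radial_mul_angular_gaussian_le {a : ℝ} (ha : 0 < a) (s : ℝ) (F : ℝ → ℝ≥0∞)
    (hF : Measurable F) (v : E3) :
    ENNReal.ofReal (1 + ‖v‖) * ∫⁻ u : E3, F ‖u‖ *
      ENNReal.ofReal (Real.exp (-a * (⟪u, v⟫ / ‖u‖ - s * ‖u‖) ^ 2)) ≤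
        ENNReal.ofReal (2 * π) * ENNReal.ofReal (4 + 2 * √(π / a)) *
          ∫⁻ r in Ioi (0 : ℝ), ENNReal.ofReal (r ^ 2) * F r := by
  obtain ⟨b, hb⟩ := exists_orthonormalBasis_eq_norm_smul v
  set R := ‖v‖ with hR
  have hR0 : 0 ≤ R := norm_nonneg v
  let H : ℝ × ℝ → ℝ≥0∞ := fun q =>
    F q.1 * ENNReal.ofReal (Real.exp (-a * (R * q.2 / q.1 - s * q.1) ^ 2))
  have hH : Measurable H := by fun_prop
  have e1 : ∫⁻ u : E3, F ‖u‖ *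
      ENNReal.ofReal (Real.exp (-a * (⟪u, v⟫ / ‖u‖ - s * ‖u‖) ^ 2)) =
        ∫⁻ y : E3, H (‖y‖, y 0) := by
    rw [← b.repr.measurePreserving.lintegral_comp
      (f := fun y : E3 => H (‖y‖, y 0)) (by fun_prop)]
    refine lintegral_congr fun u => ?_
    simp only [H, LinearIsometryEquiv.norm_map]
    rw [b.repr_apply_apply, hb, real_inner_smul_right, real_inner_comm]
  rw [e1]
  calc _ ≤ ENNReal.ofReal (1 + R) * (ENNReal.ofReal (2 * π) *
        ∫⁻ r in Ioi (0 : ℝ), ENNReal.ofReal r * ∫⁻ z in Ioo (-r) r, H (r, z)) := by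
        gcongr
        exact lintegral_norm_coord_le H hH
    _ = ENNReal.ofReal (2 * π) * ∫⁻ r in Ioi (0 : ℝ), ENNReal.ofReal (1 + R) *
        (ENNReal.ofReal r * ∫⁻ z in Ioo (-r) r, H (r, z)) := by
        rw [lintegral_const_mul' _ _ ENNReal.ofReal_ne_top, mul_left_comm]
    _ ≤ ENNReal.ofReal (2 * π) * ∫⁻ r in Ioi (0 : ℝ), ENNReal.ofReal (4 + 2 * √(π / a)) *
        (ENNReal.ofReal (r ^ 2) * F r) := by
        gcongr 1
        refine setLIntegral_mono' measurableSet_Ioi fun r hr => ?_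
        have hr' : 0 < r := hr
        simp only [H]
        rw [lintegral_const_mul _ (by fun_prop)]
        calc _ = (ENNReal.ofReal (1 + R) * ∫⁻ z in Ioo (-r) r,
              ENNReal.ofReal (Real.exp (-a * (R * z / r - s * r) ^ 2))) *
                (ENNReal.ofReal r * F r) := by ring
          _ ≤ (ENNReal.ofReal (4 + 2 * √(π / a)) * ENNReal.ofReal r) *
                (ENNReal.ofReal r * F r) := by
              refine mul_le_mul_left ?_ _
              exact lintegral_Ioo_exp_neg_sq_affine_le ha hR0 hr' _
          _ = _ := by
              rw [sq, ENNReal.ofReal_mul hr'.le]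
              ring
    _ = _ := by
        rw [lintegral_const_mul' _ _ ENNReal.ofReal_ne_top, mul_assoc]

theorem rpow_lintegral_mul_le {X : Type*} [MeasurableSpace X] {μ : Measure X} {p : ℝ}
    (hp : 1 < p) {L g : X → ℝ≥0∞} (hL : AEMeasurable L μ) (hg : AEMeasurable g μ) :
    (∫⁻ x, L x * g x ∂μ) ^ p ≤ (∫⁻ x, L x ∂μ) ^ (p - 1) * ∫⁻ x, L x * g x ^ p ∂μ := by
  have hp0 : 0 < p := by linarith
  have hpq : p.HolderConjugate (p / (p - 1)) := Real.HolderConjugate.conjExponent hp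
  have hq0 : 0 < p / (p - 1) := hpq.symm.pos
  have hsum : 1 / (p / (p - 1)) + 1 / p = 1 := by
    have : p - 1 ≠ 0 := by linarith
    field_simp
    ring
  have h := ENNReal.lintegral_mul_le_Lp_mul_Lq μ hpq.symm
    (f := fun x => L x ^ (1 / (p / (p - 1)))) (g := fun x => L x ^ (1 / p) * g x)
    (hL.pow_const _) ((hL.pow_const _).mul hg)
  have e1 : ∀ x, ((fun x => L x ^ (1 / (p / (p - 1)))) * fun x => L x ^ (1 / p) * g x) x =
      L x * g x := fun x => by
    simp only [Pi.mul_apply]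
    rw [← mul_assoc, ← ENNReal.rpow_add_of_nonneg _ _ (by positivity) (by positivity), hsum,
      ENNReal.rpow_one]
  have e2 : ∀ x, (L x ^ (1 / (p / (p - 1)))) ^ (p / (p - 1)) = L x := fun x => by
    rw [← ENNReal.rpow_mul, one_div_mul_cancel hq0.ne', ENNReal.rpow_one]
  have e3 : ∀ x, (L x ^ (1 / p) * g x) ^ p = L x * g x ^ p := fun x => by
    rw [ENNReal.mul_rpow_of_nonneg _ _ hp0.le, ← ENNReal.rpow_mul, one_div_mul_cancel hp0.ne',
      ENNReal.rpow_one]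
  simp_rw [e1, e2, e3] at h
  refine (ENNReal.rpow_le_rpow h hp0.le).trans (le_of_eq ?_)
  rw [ENNReal.mul_rpow_of_nonneg _ _ hp0.le, ← ENNReal.rpow_mul, ← ENNReal.rpow_mul,
    one_div_mul_cancel hp0.ne', ENNReal.rpow_one]
  congr 2
  field_simp

theorem lintegral_rpow_schur_le {X Y : Type*} [MeasurableSpace X] [MeasurableSpace Y]
    {μ : Measure X} {μ' : Measure Y} [SFinite μ] [SFinite μ'] {p : ℝ} (hp : 1 < p)
    {L : X → Y → ℝ≥0∞} (hL : Measurable (Function.uncurry L)) {M : ℝ≥0∞}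
    (h1 : ∀ x, ∫⁻ y, L x y ∂μ' ≤ M) (h2 : ∀ y, ∫⁻ x, L x y ∂μ ≤ M)
    {g : Y → ℝ≥0∞} (hg : Measurable g) :
    ∫⁻ x, (∫⁻ y, L x y * g y ∂μ') ^ p ∂μ ≤ M ^ p * ∫⁻ y, g y ^ p ∂μ' := by
  have hm : Measurable (Function.uncurry fun x y => L x y * g y ^ p) := by
    have : Measurable fun q : X × Y => g q.2 ^ p := by fun_prop
    exact hL.mul this
  calc _ ≤ ∫⁻ x, M ^ (p - 1) * ∫⁻ y, L x y * g y ^ p ∂μ' ∂μ := by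
        refine lintegral_mono fun x => ?_
        refine (rpow_lintegral_mul_le hp hL.of_uncurry_left.aemeasurable hg.aemeasurable).trans ?_
        exact mul_le_mul_left (ENNReal.rpow_le_rpow (h1 x) (by linarith)) _
    _ = M ^ (p - 1) * ∫⁻ y, ∫⁻ x, L x y * g y ^ p ∂μ ∂μ' := by
        rw [lintegral_const_mul _ hm.lintegral_prod_right, lintegral_lintegral_swap hm.aemeasurable]
    _ ≤ M ^ (p - 1) * ∫⁻ y, M * g y ^ p ∂μ' := by
        gcongr with y
        rw [lintegral_mul_const _ hL.of_uncurry_right]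
        gcongr
        exact h2 y
    _ = M ^ p * ∫⁻ y, g y ^ p ∂μ' := by
        rw [lintegral_const_mul _ (by fun_prop), ← mul_assoc]
        congr 1
        nth_rw 2 [← ENNReal.rpow_one M]
        rw [← ENNReal.rpow_add_of_nonneg _ _ (by linarith) zero_le_one, sub_add_cancel]

theorem lintegral_rpow_lintegral_translate_le {p : ℝ} (hp : 1 < p) {m : ℝ → ℝ≥0∞}
    (hm : Measurable m) {G : E3 → ℝ≥0∞} (hG : Measurable G) (v : E3) :
    ∫⁻ x, (∫⁻ t, m t * G (x - t • v)) ^ p ≤ (∫⁻ t, m t) ^ p * ∫⁻ x, G x ^ p := by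
  have hmG : Measurable (Function.uncurry fun (x : E3) (t : ℝ) => m t * G (x - t • v) ^ p) := by
    simp only [Function.uncurry_def]
    fun_prop
  calc _ ≤ ∫⁻ x, (∫⁻ t, m t) ^ (p - 1) * ∫⁻ t, m t * G (x - t • v) ^ p := by
        refine lintegral_mono fun x => ?_
        exact rpow_lintegral_mul_le hp hm.aemeasurable (by fun_prop)
    _ = (∫⁻ t, m t) ^ (p - 1) * ∫⁻ t, ∫⁻ x, m t * G (x - t • v) ^ p := by
        rw [lintegral_const_mul _ hmG.lintegral_prod_right,
          lintegral_lintegral_swap hmG.aemeasurable]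
    _ = (∫⁻ t, m t) ^ (p - 1) * ((∫⁻ t, m t) * ∫⁻ x, G x ^ p) := by
        congr 1
        rw [← lintegral_mul_const _ hm]
        refine lintegral_congr fun t => ?_
        rw [lintegral_const_mul _ (by fun_prop),
          lintegral_sub_right_eq_self (fun x => G x ^ p) (t • v)]
    _ = _ := by
        rw [← mul_assoc]
        congr 1
        nth_rw 2 [← ENNReal.rpow_one (∫⁻ t, m t)]
        rw [← ENNReal.rpow_add_of_nonneg _ _ (by linarith) zero_le_one, sub_add_cancel]

theorem measurable_wGamma (γ : ℝ) : Measurable (wGamma γ) := by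
  unfold wGamma
  split_ifs <;> fun_prop

theorem wGamma_nonneg (γ : ℝ) {r : ℝ} (hr : 0 ≤ r) : 0 ≤ wGamma γ r := by
  unfold wGamma
  split_ifs <;> positivity

theorem exists_sq_mul_wGamma_le {γ : ℝ} (hγ : -3 < γ) :
    ∃ s : ℝ, -1 < s ∧ ∀ r : ℝ, 0 < r → r ^ 2 * wGamma γ r ≤ 3 * (r ^ s + r ^ (2 : ℝ)) := by
  by_cases h1 : -1 < γ
  · refine ⟨1, by norm_num, fun r hr => ?_⟩
    rw [wGamma, if_pos h1, Real.rpow_one, Real.rpow_two]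
    have : r ^ 2 * (1 / r) = r := by field_simp
    rw [this]
    nlinarith [sq_nonneg r]
  by_cases h2 : γ = -1
  · refine ⟨1 / 2, by norm_num, fun r hr => ?_⟩
    rw [wGamma, if_neg h1, if_pos h2, Real.rpow_two]
    have e : r ^ 2 * ((|Real.log r| + 1) / r) = r * |Real.log r| + r := by field_simp
    rw [e]
    have hs : r ^ (1 / 2 : ℝ) * r ^ (1 / 2 : ℝ) = r := by
      rw [← Real.rpow_add hr]; norm_num
    have hs0 : 0 < r ^ (1 / 2 : ℝ) := Real.rpow_pos_of_pos hr _
    rcases le_total r 1 with hr1 | hr1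
    · have hl := Real.abs_log_mul_self_rpow_lt r (1 / 2) hr hr1 (by norm_num)
      rw [abs_mul, abs_of_pos hs0] at hl
      have hle : r ≤ r ^ (1 / 2 : ℝ) := by
        nlinarith [Real.rpow_le_one hr.le hr1 (by norm_num : (0 : ℝ) ≤ 1 / 2)]
      nlinarith
    · have hl : |Real.log r| ≤ r := by
        rw [abs_of_nonneg (Real.log_nonneg hr1)]
        linarith [Real.log_le_sub_one_of_pos hr]
      nlinarith
  · have h3 : γ < -1 := lt_of_le_of_ne (not_lt.1 h1) h2
    refine ⟨2 - |γ|, by rw [abs_of_neg (by linarith)]; linarith, fun r hr => ?_⟩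
    rw [wGamma, if_neg h1, if_neg h2, Real.rpow_sub hr, Real.rpow_two, mul_one_div]
    have : 0 < r ^ 2 / r ^ |γ| := by positivity
    nlinarith [sq_nonneg r]

theorem lintegral_sq_mul_wGamma_mul_lt_top {γ a N : ℝ} (hγ : -3 < γ) (ha : 0 < a) (hN : 0 ≤ N)
    (C : ℝ) (hC : 0 ≤ C) :
    ∫⁻ r in Ioi (0 : ℝ), ENNReal.ofReal (r ^ 2) *
      ENNReal.ofReal (C * wGamma γ r * (1 + r) ^ N * Real.exp (-a * r ^ 2)) < ∞ := by
  obtain ⟨s, hs, hw⟩ := exists_sq_mul_wGamma_le hγ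
  let f : ℝ → ℝ → ℝ := fun σ r => r ^ σ * Real.exp (-a * r ^ 2)
  have hf : ∀ σ, -1 < σ → IntegrableOn (f σ) (Ioi 0) := fun σ hσ =>
    integrableOn_rpow_mul_exp_neg_mul_sq ha hσ
  have hI : IntegrableOn (fun r => C * 3 * 2 ^ N *
      ((f s r + f 2 r) + (f (s + N) r + f (2 + N) r))) (Ioi 0) :=
    Integrable.const_mul (((hf s hs).add (hf 2 (by norm_num))).add
      ((hf (s + N) (by linarith)).add (hf (2 + N) (by linarith)))) _
  refine lt_of_le_of_lt (setLIntegral_mono' measurableSet_Ioi fun r hr => ?_) hI.lintegral_lt_top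
  have hr0 : 0 < r := hr
  rw [← ENNReal.ofReal_mul (sq_nonneg r)]
  apply ENNReal.ofReal_le_ofReal
  have hpow : (1 + r) ^ N ≤ 2 ^ N * (1 + r ^ N) := by
    rcases le_total r 1 with h | h
    · calc (1 + r) ^ N ≤ 2 ^ N := Real.rpow_le_rpow (by linarith) (by linarith) hN
        _ ≤ _ := le_mul_of_one_le_right (by positivity) (by linarith [Real.rpow_nonneg hr0.le N])
    · calc (1 + r) ^ N ≤ (2 * r) ^ N := Real.rpow_le_rpow (by linarith) (by linarith) hN
        _ = 2 ^ N * r ^ N := Real.mul_rpow (by norm_num) hr0.le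
        _ ≤ _ := by gcongr; linarith
  have hw0 := wGamma_nonneg γ hr0.le
  calc r ^ 2 * (C * wGamma γ r * (1 + r) ^ N * Real.exp (-a * r ^ 2))
      = C * (r ^ 2 * wGamma γ r) * (1 + r) ^ N * Real.exp (-a * r ^ 2) := by ring
    _ ≤ C * (3 * (r ^ s + r ^ (2 : ℝ))) * (2 ^ N * (1 + r ^ N)) * Real.exp (-a * r ^ 2) := by
        have h3 : C * (r ^ 2 * wGamma γ r) ≤ C * (3 * (r ^ s + r ^ (2 : ℝ))) :=
          mul_le_mul_of_nonneg_left (hw r hr0) hC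
        gcongr
    _ = _ := by
        simp only [f]
        rw [Real.rpow_add hr0, Real.rpow_add hr0]
        ring

theorem integrable_norm_rpow_mul_exp_neg_sq {γ : ℝ} (hγ : -3 < γ) (v : E3) :
    Integrable fun w : E3 => ‖v - w‖ ^ γ * Real.exp (-‖w‖ ^ 2) := by
  have h0 : Integrable fun u : E3 => ‖u‖ ^ γ * Real.exp (-(1 / 2) * ‖u‖ ^ 2) := by
    refine (integrable_fun_norm_addHaar volume
      (f := fun r : ℝ => r ^ γ * Real.exp (-(1 / 2) * r ^ 2))).2 ?_
    refine (integrableOn_rpow_mul_exp_neg_mul_sq (b := 1 / 2) (by norm_num)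
      (s := 2 + γ) (by linarith)).congr_fun (fun r hr => ?_) measurableSet_Ioi
    have hr0 : 0 < r := hr
    simp only [finrank_euclideanSpace, Fintype.card_fin, smul_eq_mul]
    rw [Real.rpow_add hr0, Real.rpow_two]
    ring
  have h1 := (h0.comp_sub_left v).const_mul (Real.exp (‖v‖ ^ 2))
  refine h1.mono' (by fun_prop) (ae_of_all _ fun w => ?_)
  rw [Real.norm_of_nonneg (by positivity), mul_left_comm, ← Real.exp_add]
  gcongr
  have : ‖v - w‖ ≤ ‖v‖ + ‖w‖ := norm_sub_le v w
  nlinarith [sq_nonneg (‖v‖ - ‖w‖), norm_nonneg (v - w), norm_nonneg v, norm_nonneg w]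

theorem exists_pos_le_nu {B₀ γ : ℝ} (hB₀ : 0 < B₀) (hγ : -3 < γ) :
    ∃ c > (0 : ℝ), ∀ v : E3, ‖v‖ ≤ 1 → c ≤ nu B₀ γ v := by
  let S : Set E3 := Metric.ball 0 3 \ Metric.closedBall 0 2
  have hSo : IsOpen S := Metric.isOpen_ball.sdiff Metric.isClosed_closedBall
  have hSne : S.Nonempty := ⟨EuclideanSpace.single 0 (5 / 2), by
    simp only [S, mem_sdiff, mem_ball_zero_iff, mem_closedBall_zero_iff,
      PiLp.norm_single]
    norm_num⟩
  have hSpos : 0 < volume.real S :=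
    ENNReal.toReal_pos (hSo.measure_pos volume hSne).ne'
      ((measure_mono sdiff_subset).trans_lt measure_ball_lt_top).ne
  have hSfin : volume S ≠ ∞ := ((measure_mono sdiff_subset).trans_lt measure_ball_lt_top).ne
  let κ : ℝ := (4 : ℝ) ^ (-3 : ℝ) * Real.exp (-9)
  have hκ : 0 < κ := by positivity
  refine ⟨B₀ * π * (κ * volume.real S), by positivity, fun v hv => ?_⟩
  unfold nu
  refine mul_le_mul_of_nonneg_left ?_ (by positivity)
  have hI := integrable_norm_rpow_mul_exp_neg_sq hγ v
  calc κ * volume.real S = ∫ w in S, κ := by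
        rw [setIntegral_const, smul_eq_mul, mul_comm]
    _ ≤ ∫ w in S, ‖v - w‖ ^ γ * Real.exp (-‖w‖ ^ 2) := by
        refine setIntegral_mono_on (integrableOn_const hSfin) hI.integrableOn
          hSo.measurableSet fun w hw => ?_
        have hw3 : ‖w‖ < 3 := mem_ball_zero_iff.1 hw.1
        have hw2 : 2 < ‖w‖ := by
          simpa using hw.2
        have h1 : 1 ≤ ‖v - w‖ := by
          have := norm_sub_norm_le w v
          rw [norm_sub_rev] at this
          linarith
        have h4 : ‖v - w‖ ≤ 4 := (norm_sub_le v w).trans (by linarith)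
        have : (4 : ℝ) ^ (-3 : ℝ) ≤ ‖v - w‖ ^ γ :=
          calc (4 : ℝ) ^ (-3 : ℝ) ≤ ‖v - w‖ ^ (-3 : ℝ) :=
                Real.rpow_le_rpow_of_nonpos (by linarith) h4 (by norm_num)
            _ ≤ _ := Real.rpow_le_rpow_of_exponent_le h1 hγ.le
        have h9 : Real.exp (-9) ≤ Real.exp (-‖w‖ ^ 2) := by
          apply Real.exp_le_exp.2
          nlinarith
        exact mul_le_mul this h9 (Real.exp_pos _).le (by positivity)
    _ ≤ _ := setIntegral_le_integral hI (ae_of_all _ fun w => by positivity)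

open Classical in
/-- A majorant of the time weight of `S_Ω` that is jointly measurable: it vanishes unless
`0 < t` and `t ‖v‖ ≤ D`, and keeps the exponential decay for small velocities only. -/
def timeWeight (c D : ℝ) (v : E3) (t : ℝ) : ℝ≥0∞ :=
  if 0 < t ∧ t * ‖v‖ ≤ D then
    if ‖v‖ ≤ 1 then ENNReal.ofReal (Real.exp (-c * t)) else 1
  else 0

theorem measurable_timeWeight (c D : ℝ) : Measurable (Function.uncurry (timeWeight c D)) := by
  unfold timeWeight
  simp only [Function.uncurry_def]
  refine Measurable.ite ?_ (Measurable.ite ?_ (by fun_prop) (by fun_prop)) (by fun_prop)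
  · have h1 : MeasurableSet {q : E3 × ℝ | 0 < q.2} := measurableSet_lt (by fun_prop) (by fun_prop)
    have h2 : MeasurableSet {q : E3 × ℝ | q.2 * ‖q.1‖ ≤ D} :=
      measurableSet_le (by fun_prop) (by fun_prop)
    exact h1.inter h2
  · exact measurableSet_le (by fun_prop) (by fun_prop)

theorem one_add_norm_mul_lintegral_timeWeight_le {c D : ℝ} (hc : 0 < c) (hD : 0 ≤ D) (v : E3) :
    ENNReal.ofReal (1 + ‖v‖) * ∫⁻ t, timeWeight c D v t ≤ ENNReal.ofReal (2 / c + 2 * D) := by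
  rcases le_or_gt ‖v‖ 1 with hv | hv
  · calc _ ≤ ENNReal.ofReal 2 * ∫⁻ t in Ioi (0 : ℝ), ENNReal.ofReal (Real.exp (-c * t)) := by
          refine mul_le_mul' (ENNReal.ofReal_le_ofReal (by linarith)) ?_
          rw [← lintegral_indicator measurableSet_Ioi]
          refine lintegral_mono fun t => ?_
          unfold timeWeight
          split_ifs with h1
          · rw [indicator_of_mem (show t ∈ Ioi (0 : ℝ) from h1.1)]
          · exact zero_le
      _ = ENNReal.ofReal (2 / c) := by
          rw [← ofReal_integral_eq_lintegral_ofReal (integrableOn_exp_mul_Ioi (by linarith) 0)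
            (ae_of_all _ fun t => (Real.exp_pos _).le), integral_exp_mul_Ioi (by linarith),
            ← ENNReal.ofReal_mul (by norm_num)]
          congr 1
          simp only [mul_zero, Real.exp_zero]
          field_simp
      _ ≤ _ := ENNReal.ofReal_le_ofReal (by linarith)
  · have hv0 : 0 < ‖v‖ := by linarith
    calc _ ≤ ENNReal.ofReal (1 + ‖v‖) * ∫⁻ t in Ioc (0 : ℝ) (D / ‖v‖), 1 := by
          refine mul_le_mul_right ?_ _
          rw [← lintegral_indicator measurableSet_Ioc]
          refine lintegral_mono fun t => ?_
          unfold timeWeight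
          split_ifs with h1 h2
          · exact absurd hv (not_lt.2 h2)
          · rw [indicator_of_mem
              (show t ∈ Ioc (0 : ℝ) (D / ‖v‖) from ⟨h1.1, (le_div_iff₀ hv0).2 h1.2⟩)]
          · exact zero_le
      _ = ENNReal.ofReal ((1 + ‖v‖) * (D / ‖v‖)) := by
          rw [setLIntegral_one, Real.volume_Ioc, sub_zero, ← ENNReal.ofReal_mul (by positivity)]
      _ ≤ _ := by
          apply ENNReal.ofReal_le_ofReal
          have h2 : (1 + ‖v‖) * (D / ‖v‖) = D / ‖v‖ + D := by field_simp
          have h3 : D / ‖v‖ ≤ D := div_le_self hD hv.le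
          have h4 : 0 < 2 / c := by positivity
          linarith

theorem mem_of_mem_tauItv {Ω : Set E3} {x v : E3} {t : ℝ} (ht : t ∈ tauItv Ω x v) :
    x - t • v ∈ Ω := by
  by_contra h
  exact absurd ht.2 (not_lt.2 (sInf_le ⟨t, ⟨ht.1, h⟩, rfl⟩))

theorem enorm_SOmK_le {Ω : Set E3} (hΩ : MeasurableSet Ω) {D : ℝ}
    (hD : ∀ x ∈ Ω, ∀ y ∈ Ω, dist x y ≤ D) {B₀ γ c : ℝ}
    (hc : ∀ v : E3, ‖v‖ ≤ 1 → c ≤ nu B₀ γ v) (hnu : ∀ v : E3, 0 ≤ nu B₀ γ v)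
    (k h : E3 → E3 → ℝ) {x : E3} (hx : x ∈ Ω) (v : E3) :
    ‖SOmK Ω B₀ γ k h x v‖ₑ ≤ ∫⁻ t, timeWeight c D v t *
      Ω.indicator (fun y => ∫⁻ vs, ‖k v vs * h y vs‖ₑ) (x - t • v) := by
  let A : Set ℝ := {t | 0 < t ∧ t * ‖v‖ ≤ D} ∩ {t | x - t • v ∈ Ω}
  have h1 : MeasurableSet {t : ℝ | 0 < t} := measurableSet_Ioi
  have h2 : MeasurableSet {t : ℝ | t * ‖v‖ ≤ D} := measurableSet_le (by fun_prop) (by fun_prop)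
  have hA : MeasurableSet A :=
    (h1.inter h2).inter (measurableSet_preimage (f := fun t : ℝ => x - t • v) (by fun_prop) hΩ)
  have hsub : tauItv Ω x v ⊆ A := fun t ht => by
    have hm := mem_of_mem_tauItv ht
    refine ⟨⟨ht.1, ?_⟩, hm⟩
    have := hD x hx _ hm
    rwa [dist_eq_norm, sub_sub_cancel, norm_smul, Real.norm_of_nonneg ht.1.le] at this
  unfold SOmK
  refine (enorm_integral_le_lintegral_enorm _).trans ((lintegral_mono_set hsub).trans ?_)
  rw [← lintegral_indicator hA]
  refine lintegral_mono fun t => ?_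
  by_cases ht : t ∈ A
  · rw [indicator_of_mem ht, indicator_of_mem (show x - t • v ∈ Ω from ht.2), enorm_mul]
    refine mul_le_mul' ?_ (enorm_integral_le_lintegral_enorm _)
    rw [timeWeight, if_pos (show 0 < t ∧ t * ‖v‖ ≤ D from ht.1), Real.enorm_of_nonneg (Real.exp_pos _).le]
    have ht0 : 0 < t := ht.1.1
    split_ifs with h1
    · apply ENNReal.ofReal_le_ofReal
      apply Real.exp_le_exp.2
      nlinarith [hc v h1]
    · rw [ENNReal.ofReal_le_one, Real.exp_le_one_iff]
      nlinarith [hnu v]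
  · rw [indicator_of_notMem ht]
    exact zero_le

theorem nu_nonneg {B₀ : ℝ} (hB₀ : 0 < B₀) (γ : ℝ) (v : E3) : 0 ≤ nu B₀ γ v :=
  mul_nonneg (by positivity) (integral_nonneg fun w => by positivity)

theorem one_add_norm_le_mul (v w : E3) : 1 + ‖v‖ ≤ (1 + ‖w‖) * (1 + ‖v - w‖) := by
  have : ‖v‖ ≤ ‖w‖ + ‖v - w‖ := by simpa using norm_add_le w (v - w)
  nlinarith [mul_nonneg (norm_nonneg w) (norm_nonneg (v - w))]

theorem rpow_mul_rpow_neg_le {a b c : ℝ} (ha : 0 < a) (hb : 0 < b)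
    (hab : a ≤ b * c) (hba : b ≤ a * c) (β : ℝ) : a ^ β * b ^ (-β) ≤ c ^ |β| := by
  rcases le_total 0 β with h | h
  · rw [abs_of_nonneg h, Real.rpow_neg hb.le, ← div_eq_mul_inv, ← Real.div_rpow ha.le hb.le]
    exact Real.rpow_le_rpow (by positivity) ((div_le_iff₀' hb).2 hab) h
  · rw [abs_of_nonpos h]
    have : a ^ β = (a ^ (-β))⁻¹ := by rw [Real.rpow_neg ha.le, inv_inv]
    rw [this, mul_comm, ← div_eq_mul_inv, ← Real.div_rpow hb.le ha.le]
    exact Real.rpow_le_rpow (by positivity) ((div_le_iff₀' ha).2 hba) (by linarith)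

theorem kernel_weight_le {γ : ℝ} (hγ : γ ≤ 1) (β : ℝ) (v w : E3) :
    (1 + ‖v‖ + ‖w‖) ^ (γ - 1) * ((1 + ‖v‖) ^ (β + 2 - γ) * (1 + ‖w‖) ^ (-β)) ≤
      (1 + ‖v - w‖) ^ |β| * (1 + ‖v‖) := by
  have hv : 0 < 1 + ‖v‖ := by positivity
  have hw : 0 < 1 + ‖w‖ := by positivity
  calc _ ≤ (1 + ‖v‖) ^ (γ - 1) * ((1 + ‖v‖) ^ (β + 2 - γ) * (1 + ‖w‖) ^ (-β)) := by
        refine mul_le_mul_of_nonneg_right ?_ (by positivity)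
        exact Real.rpow_le_rpow_of_nonpos hv (by linarith [norm_nonneg w]) (by linarith)
    _ = (1 + ‖v‖) ^ β * (1 + ‖w‖) ^ (-β) * (1 + ‖v‖) := by
        rw [← mul_assoc, ← Real.rpow_add hv, show γ - 1 + (β + 2 - γ) = β + 1 by ring,
          Real.rpow_add_one hv.ne']
        ring
    _ ≤ _ := by
        refine mul_le_mul_of_nonneg_right ?_ hv.le
        refine rpow_mul_rpow_neg_le hv hw (one_add_norm_le_mul v w) ?_ β
        rw [norm_sub_rev]
        exact one_add_norm_le_mul w v

theorem kernel_weight_le_fst {γ : ℝ} (hγ : γ ≤ 1) (β : ℝ) (v w : E3) :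
    (1 + ‖v‖ + ‖w‖) ^ (γ - 1) * ((1 + ‖v‖) ^ (β + 2 - γ) * (1 + ‖w‖) ^ (-β)) ≤
      (1 + ‖v - w‖) ^ (|β| + 1) * (1 + ‖v‖) := by
  refine (kernel_weight_le hγ β v w).trans ?_
  gcongr
  · linarith [norm_nonneg (v - w)]
  · linarith

theorem kernel_weight_le_snd {γ : ℝ} (hγ : γ ≤ 1) (β : ℝ) (v w : E3) :
    (1 + ‖v‖ + ‖w‖) ^ (γ - 1) * ((1 + ‖v‖) ^ (β + 2 - γ) * (1 + ‖w‖) ^ (-β)) ≤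
      (1 + ‖v - w‖) ^ (|β| + 1) * (1 + ‖w‖) := by
  refine (kernel_weight_le hγ β v w).trans ?_
  rw [Real.rpow_add_one (by positivity), mul_assoc, mul_comm (1 + ‖v - w‖)]
  gcongr
  exact one_add_norm_le_mul v w

/-- The conjugated kernel with the polynomial weights of the source and target spaces. -/
def weightedKernel (α β γ : ℝ) (k : E3 → E3 → ℝ) (v w : E3) : ℝ≥0∞ :=
  ENNReal.ofReal (|Real.exp (α * ‖v‖ ^ 2) * k v w * Real.exp (-α * ‖w‖ ^ 2)| *
    ((1 + ‖v‖) ^ (β + 2 - γ) * (1 + ‖w‖) ^ (-β)))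

theorem measurable_weightedKernel (α β γ : ℝ) {k : E3 → E3 → ℝ}
    (hk : Measurable (Function.uncurry k)) :
    Measurable (Function.uncurry (weightedKernel α β γ k)) := by
  have hk' : Measurable fun q : E3 × E3 => k q.1 q.2 := hk
  unfold weightedKernel
  simp only [Function.uncurry_def]
  fun_prop

theorem ofReal_abs_mul_weight_le {κ W A P X E T Z : ℝ} (hκ : |κ| ≤ A * P * X * E)
    (hW : 0 ≤ W) (hA : 0 ≤ A) (hX : 0 ≤ X) (hE : 0 ≤ E) (hT : 0 ≤ T) (hZ : 0 ≤ Z)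
    (hPW : P * W ≤ T * Z) :
    ENNReal.ofReal (|κ| * W) ≤
      ENNReal.ofReal Z * (ENNReal.ofReal (A * T * X) * ENNReal.ofReal E) := by
  rw [← ENNReal.ofReal_mul (by positivity), ← ENNReal.ofReal_mul hZ]
  apply ENNReal.ofReal_le_ofReal
  calc |κ| * W ≤ A * P * X * E * W := mul_le_mul_of_nonneg_right hκ hW
    _ = A * X * E * (P * W) := by ring
    _ ≤ A * X * E * (T * Z) := mul_le_mul_of_nonneg_left hPW (by positivity)
    _ = Z * (A * T * X * E) := by ring

theorem exists_weightedKernel_schur_bound {α β γ C₀ α₁ α₂ α₃ : ℝ} (hγl : -3 < γ) (hγu : γ ≤ 1)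
    (hC₀ : 0 < C₀) (hα₁ : 0 < α₁) (hα₃ : 0 < α₃) (k : E3 → E3 → ℝ)
    (hb1 : ∀ v vs : E3, v ≠ vs →
      |Real.exp (α * ‖v‖ ^ 2) * k v vs * Real.exp (-α * ‖vs‖ ^ 2)| ≤
        C₀ * wGamma γ ‖v - vs‖ * (1 + ‖v‖ + ‖vs‖) ^ (γ - 1) *
          Real.exp (-α₁ * ‖v - vs‖ ^ 2) *
          Real.exp (-α₃ * (⟪v - vs, v⟫ / ‖v - vs‖ - α₂ * ‖v - vs‖) ^ 2))
    (hb2 : ∀ v vs : E3, v ≠ vs →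
      |Real.exp (α * ‖v‖ ^ 2) * k v vs * Real.exp (-α * ‖vs‖ ^ 2)| ≤
        C₀ * wGamma γ ‖v - vs‖ * (1 + ‖v‖ + ‖vs‖) ^ (γ - 1) *
          Real.exp (-α₁ * ‖v - vs‖ ^ 2) *
          Real.exp (-α₃ * (⟪v - vs, vs⟫ / ‖v - vs‖ + α₂ * ‖v - vs‖) ^ 2)) :
    ∃ M : ℝ≥0∞, M < ∞ ∧ (∀ v, ∫⁻ w, weightedKernel α β γ k v w ≤ M) ∧
      ∀ w, ∫⁻ v, weightedKernel α β γ k v w ≤ M := by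
  let F : ℝ → ℝ≥0∞ := fun r =>
    ENNReal.ofReal (C₀ * wGamma γ r * (1 + r) ^ (|β| + 1) * Real.exp (-α₁ * r ^ 2))
  have hF : Measurable F := by
    have := measurable_wGamma γ
    fun_prop
  have hA : ∀ v w : E3, 0 ≤ C₀ * wGamma γ ‖v - w‖ := fun v w =>
    mul_nonneg hC₀.le (wGamma_nonneg γ (norm_nonneg _))
  refine ⟨ENNReal.ofReal (2 * π) * ENNReal.ofReal (4 + 2 * √(π / α₃)) *
    ∫⁻ r in Ioi (0 : ℝ), ENNReal.ofReal (r ^ 2) * F r, ?_, fun v => ?_, fun w => ?_⟩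
  · exact ENNReal.mul_lt_top (ENNReal.mul_lt_top ENNReal.ofReal_lt_top ENNReal.ofReal_lt_top)
      (lintegral_sq_mul_wGamma_mul_lt_top hγl hα₁ (by positivity) C₀ hC₀.le)
  · refine le_trans ?_ (lintegral_radial_mul_angular_gaussian_le hα₃ α₂ F hF v)
    rw [← lintegral_sub_left_eq_self (fun u => F ‖u‖ *
      ENNReal.ofReal (Real.exp (-α₃ * (⟪u, v⟫ / ‖u‖ - α₂ * ‖u‖) ^ 2))) v,
      ← lintegral_const_mul' _ _ ENNReal.ofReal_ne_top]
    refine lintegral_mono_ae ?_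
    filter_upwards [Measure.ae_ne volume v] with w hw
    exact ofReal_abs_mul_weight_le (hb1 v w hw.symm) (by positivity) (hA v w) (by positivity)
      (by positivity) (by positivity) (by positivity) (kernel_weight_le_fst hγu β v w)
  · refine le_trans ?_ (lintegral_radial_mul_angular_gaussian_le hα₃ (-α₂) F hF w)
    rw [← lintegral_sub_right_eq_self (fun u => F ‖u‖ *
      ENNReal.ofReal (Real.exp (-α₃ * (⟪u, w⟫ / ‖u‖ - -α₂ * ‖u‖) ^ 2))) w,
      ← lintegral_const_mul' _ _ ENNReal.ofReal_ne_top]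
    refine lintegral_mono_ae ?_
    filter_upwards [Measure.ae_ne volume w] with v hv
    simp only [neg_mul, sub_neg_eq_add]
    have := hb2 v w hv
    simp only [neg_mul] at this
    refine ofReal_abs_mul_weight_le ?_ (by positivity) (hA v w) (by positivity)
      (by positivity) (by positivity) (by positivity) (kernel_weight_le_snd hγu β v w)
    simpa only [neg_mul] using this

theorem lintegral_SOmK_rpow_le {Ω : Set E3} (hΩ : MeasurableSet Ω) {D : ℝ} (hD0 : 0 ≤ D)
    (hD : ∀ x ∈ Ω, ∀ y ∈ Ω, dist x y ≤ D) {B₀ γ c p : ℝ} (hp : 1 < p) (hc0 : 0 < c)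
    (hc : ∀ v : E3, ‖v‖ ≤ 1 → c ≤ nu B₀ γ v) (hnu : ∀ v : E3, 0 ≤ nu B₀ γ v)
    {k h : E3 → E3 → ℝ} (hk : Measurable (Function.uncurry k))
    (hh : Measurable (Function.uncurry h)) {W : E3 → ℝ≥0∞} (hW : Measurable W) :
    ∫⁻ x in Ω, ∫⁻ v, (W v * ENNReal.ofReal (1 + ‖v‖) * ‖SOmK Ω B₀ γ k h x v‖ₑ) ^ p ≤
      ENNReal.ofReal (2 / c + 2 * D) ^ p *
        ∫⁻ x in Ω, ∫⁻ v, (W v * ∫⁻ w, ‖k v w * h x w‖ₑ) ^ p := by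
  have hp0 : 0 < p := by linarith
  let G : E3 → E3 → ℝ≥0∞ := fun v => Ω.indicator fun y => ∫⁻ w, ‖k v w * h y w‖ₑ
  have hGm : Measurable fun q : E3 × E3 => G q.1 q.2 := by
    have hk' : Measurable fun q : (E3 × E3) × E3 => k q.1.1 q.2 :=
      hk.comp (f := fun q : (E3 × E3) × E3 => (q.1.1, q.2)) (by fun_prop)
    have hh' : Measurable fun q : (E3 × E3) × E3 => h q.1.2 q.2 :=
      hh.comp (f := fun q : (E3 × E3) × E3 => (q.1.2, q.2)) (by fun_prop)
    have h1 : Measurable fun q : E3 × E3 => ∫⁻ w, ‖k q.1 w * h q.2 w‖ₑ :=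
      Measurable.lintegral_prod_right' (f := fun q : (E3 × E3) × E3 =>
        ‖k q.1.1 q.2 * h q.1.2 q.2‖ₑ) (hk'.mul hh').enorm
    exact h1.indicator (hΩ.preimage measurable_snd)
  have hG : ∀ v, Measurable (G v) := fun v => hGm.comp (f := fun y => (v, y)) (by fun_prop)
  have htw := measurable_timeWeight c D
  let A : E3 → E3 → ℝ≥0∞ := fun x v => ∫⁻ t, timeWeight c D v t * G v (x - t • v)
  have hAm : Measurable fun q : E3 × E3 => A q.1 q.2 := by
    refine Measurable.lintegral_prod_right' (f := fun q : (E3 × E3) × ℝ =>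
      timeWeight c D q.1.2 q.2 * G q.1.2 (q.1.1 - q.2 • q.1.2)) ?_
    exact (htw.comp (f := fun q : (E3 × E3) × ℝ => (q.1.2, q.2)) (by fun_prop)).mul
      (hGm.comp (f := fun q : (E3 × E3) × ℝ => (q.1.2, q.1.1 - q.2 • q.1.2)) (by fun_prop))
  calc _ ≤ ∫⁻ x in Ω, ∫⁻ v, (W v * ENNReal.ofReal (1 + ‖v‖) * A x v) ^ p := by
        refine setLIntegral_mono' hΩ fun x hx => lintegral_mono fun v => ?_
        exact ENNReal.rpow_le_rpow
          (mul_le_mul_right (enorm_SOmK_le hΩ hD hc hnu k h hx v) _) hp0.le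
    _ ≤ ∫⁻ x, ∫⁻ v, (W v * ENNReal.ofReal (1 + ‖v‖) * A x v) ^ p := setLIntegral_le_lintegral _ _
    _ = ∫⁻ v, ∫⁻ x, (W v * ENNReal.ofReal (1 + ‖v‖) * A x v) ^ p := by
        refine lintegral_lintegral_swap (Measurable.aemeasurable ?_)
        simp only [Function.uncurry_def]
        fun_prop
    _ ≤ ∫⁻ v, ∫⁻ x, ENNReal.ofReal (2 / c + 2 * D) ^ p * (W v * G v x) ^ p := by
        refine lintegral_mono fun v => ?_
        have hAv : Measurable fun x => A x v := hAm.comp (f := fun x => (x, v)) (by fun_prop)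
        simp only [ENNReal.mul_rpow_of_nonneg _ _ hp0.le]
        rw [lintegral_const_mul _ (by fun_prop)]
        calc _ ≤ W v ^ p * ENNReal.ofReal (1 + ‖v‖) ^ p *
              ((∫⁻ t, timeWeight c D v t) ^ p * ∫⁻ x, G v x ^ p) :=
              mul_le_mul_right (lintegral_rpow_lintegral_translate_le hp
                htw.of_uncurry_left (hG v) v) _
          _ = (ENNReal.ofReal (1 + ‖v‖) * ∫⁻ t, timeWeight c D v t) ^ p *
              (W v ^ p * ∫⁻ x, G v x ^ p) := by
              rw [ENNReal.mul_rpow_of_nonneg _ _ hp0.le]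
              ring
          _ ≤ ENNReal.ofReal (2 / c + 2 * D) ^ p * (W v ^ p * ∫⁻ x, G v x ^ p) :=
              mul_le_mul_left (ENNReal.rpow_le_rpow
                (one_add_norm_mul_lintegral_timeWeight_le hc0 hD0 v) hp0.le) _
          _ = _ := by
              have := hG v
              rw [lintegral_const_mul _ (by fun_prop), lintegral_const_mul _ (by fun_prop)]
    _ = ∫⁻ x, ∫⁻ v, ENNReal.ofReal (2 / c + 2 * D) ^ p * (W v * G v x) ^ p := by
        refine lintegral_lintegral_swap (Measurable.aemeasurable ?_)
        simp only [Function.uncurry_def]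
        fun_prop
    _ = ENNReal.ofReal (2 / c + 2 * D) ^ p * ∫⁻ x, ∫⁻ v, (W v * G v x) ^ p := by
        have hfin : ENNReal.ofReal (2 / c + 2 * D) ^ p ≠ ∞ :=
          ENNReal.rpow_ne_top_of_nonneg hp0.le ENNReal.ofReal_ne_top
        simp_rw [lintegral_const_mul' _ _ hfin]
    _ = _ := by
        congr 1
        rw [← lintegral_indicator hΩ]
        refine lintegral_congr fun x => ?_
        by_cases hx : x ∈ Ω
        · simp only [G, indicator_of_mem hx]
        · simp only [G, indicator_of_notMem hx, mul_zero, ENNReal.zero_rpow_of_pos hp0,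
            lintegral_zero]

theorem lintegral_weight_mul_kernel_rpow_le {α β γ p : ℝ} (hp : 1 < p) {k : E3 → E3 → ℝ}
    (hk : Measurable (Function.uncurry k)) {M : ℝ≥0∞}
    (h1 : ∀ v, ∫⁻ w, weightedKernel α β γ k v w ≤ M)
    (h2 : ∀ w, ∫⁻ v, weightedKernel α β γ k v w ≤ M) {f : E3 → ℝ} (hf : Measurable f) :
    ∫⁻ v, (ENNReal.ofReal (Real.exp (α * ‖v‖ ^ 2) * (1 + ‖v‖) ^ (β + 2 - γ)) *
      ∫⁻ w, ‖k v w * f w‖ₑ) ^ p ≤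
        M ^ p * ∫⁻ v, ENNReal.ofReal
          (|f v| ^ p * Real.exp (p * α * ‖v‖ ^ 2) * (1 + ‖v‖) ^ (p * β)) := by
  have hp0 : 0 < p := by linarith
  let g : E3 → ℝ≥0∞ := fun w =>
    ENNReal.ofReal (|f w| * Real.exp (α * ‖w‖ ^ 2) * (1 + ‖w‖) ^ β)
  have hg : Measurable g := by fun_prop
  refine le_trans (le_of_eq ?_) ((lintegral_rpow_schur_le hp
    (measurable_weightedKernel α β γ hk) h1 h2 hg).trans (le_of_eq ?_))
  · refine lintegral_congr fun v => ?_
    rw [← lintegral_const_mul' _ _ ENNReal.ofReal_ne_top]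
    congr 1
    refine lintegral_congr fun w => ?_
    simp only [g, weightedKernel]
    rw [← ENNReal.ofReal_mul (by positivity), ← ofReal_norm, ← ENNReal.ofReal_mul (by positivity)]
    congr 1
    have e1 : Real.exp (-α * ‖w‖ ^ 2) * Real.exp (α * ‖w‖ ^ 2) = 1 := by
      rw [← Real.exp_add]; simp
    have e2 : (1 + ‖w‖) ^ (-β) * (1 + ‖w‖) ^ β = 1 := by
      rw [← Real.rpow_add (by positivity)]; simp
    rw [Real.norm_eq_abs, abs_mul, abs_mul, abs_mul, abs_of_pos (Real.exp_pos _),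
      abs_of_pos (Real.exp_pos _)]
    calc _ = Real.exp (α * ‖v‖ ^ 2) * (1 + ‖v‖) ^ (β + 2 - γ) * (|k v w| * |f w|) *
          (Real.exp (-α * ‖w‖ ^ 2) * Real.exp (α * ‖w‖ ^ 2)) *
            ((1 + ‖w‖) ^ (-β) * (1 + ‖w‖) ^ β) := by rw [e1, e2, mul_one, mul_one]
      _ = _ := by ring
  · congr 1
    refine lintegral_congr fun v => ?_
    simp only [g]
    rw [ENNReal.ofReal_rpow_of_nonneg (by positivity) hp0.le,
      Real.mul_rpow (by positivity) (by positivity), Real.mul_rpow (by positivity) (by positivity),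
      ← Real.exp_mul, ← Real.rpow_mul (by positivity)]
    ring_nf

/-- `S_Ω K` gains the polynomial weight `(1+|v|)^{3−γ}`: it maps `L^p_{α,β₁}(Ω × ℝ³)`
boundedly into `L^p_{α,β₁+3−γ}(Ω × ℝ³)`. -/
theorem SOmega_K_polynomial_gain (Ω : Set E3) (hΩo : IsOpen Ω)
    (hΩb : Bornology.IsBounded Ω) (hΩc : Convex ℝ Ω)
    (α β₁ γ p B₀ C₀ α₁ α₂ α₃ : ℝ) (hα : 0 ≤ α) (hγl : -3 < γ) (hγu : γ ≤ 1)
    (hp : 2 ≤ p) (hB₀ : 0 < B₀) (hC₀ : 0 < C₀) (hα₁ : 0 < α₁) (hα₂ : 0 < α₂) (hα₃ : 0 < α₃)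
    (k : E3 → E3 → ℝ) (hmeas : Measurable (Function.uncurry k))
    (hb1 : ∀ v vs : E3, v ≠ vs →
      |Real.exp (α * ‖v‖ ^ 2) * k v vs * Real.exp (-α * ‖vs‖ ^ 2)| ≤
        C₀ * wGamma γ ‖v - vs‖ * (1 + ‖v‖ + ‖vs‖) ^ (γ - 1) *
          Real.exp (-α₁ * ‖v - vs‖ ^ 2) *
          Real.exp (-α₃ * (⟪v - vs, v⟫ / ‖v - vs‖ - α₂ * ‖v - vs‖) ^ 2))
    (hb2 : ∀ v vs : E3, v ≠ vs →
      |Real.exp (α * ‖v‖ ^ 2) * k v vs * Real.exp (-α * ‖vs‖ ^ 2)| ≤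
        C₀ * wGamma γ ‖v - vs‖ * (1 + ‖v‖ + ‖vs‖) ^ (γ - 1) *
          Real.exp (-α₁ * ‖v - vs‖ ^ 2) *
          Real.exp (-α₃ * (⟪v - vs, vs⟫ / ‖v - vs‖ + α₂ * ‖v - vs‖) ^ 2)) :
    ∃ C > (0 : ℝ), ∀ h : E3 → E3 → ℝ, Measurable (Function.uncurry h) →
      (∫⁻ x in Ω, ∫⁻ v : E3, ENNReal.ofReal
          (|SOmK Ω B₀ γ k h x v| ^ p * Real.exp (p * α * ‖v‖ ^ 2) *
            (1 + ‖v‖) ^ (p * (β₁ + 3 - γ)))) ≤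
        ENNReal.ofReal C * ∫⁻ x in Ω, ∫⁻ v : E3, ENNReal.ofReal
          (|h x v| ^ p * Real.exp (p * α * ‖v‖ ^ 2) * (1 + ‖v‖) ^ (p * β₁)) := by
  have hp1 : 1 < p := by linarith
  have hp0 : 0 < p := by linarith
  obtain ⟨c, hc0, hc⟩ := exists_pos_le_nu hB₀ hγl
  obtain ⟨M, hM, h1, h2⟩ := exists_weightedKernel_schur_bound (β := β₁) hγl hγu hC₀ hα₁ hα₃ k
    hb1 hb2
  let T : ℝ≥0∞ := ENNReal.ofReal (2 / c + 2 * Metric.diam Ω) ^ p * M ^ p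
  have hT : T ≠ ∞ := ENNReal.mul_ne_top
    (ENNReal.rpow_ne_top_of_nonneg hp0.le ENNReal.ofReal_ne_top)
    (ENNReal.rpow_ne_top_of_nonneg hp0.le hM.ne)
  refine ⟨T.toReal + 1, by positivity, fun h hh => ?_⟩
  have hTC : T ≤ ENNReal.ofReal (T.toReal + 1) := by
    rw [← ENNReal.ofReal_toReal hT]
    exact ENNReal.ofReal_le_ofReal (by rw [ENNReal.ofReal_toReal hT]; linarith)
  let W : E3 → ℝ≥0∞ := fun v =>
    ENNReal.ofReal (Real.exp (α * ‖v‖ ^ 2) * (1 + ‖v‖) ^ (β₁ + 2 - γ))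
  have hW : Measurable W := by fun_prop
  calc _ = ∫⁻ x in Ω, ∫⁻ v,
        (W v * ENNReal.ofReal (1 + ‖v‖) * ‖SOmK Ω B₀ γ k h x v‖ₑ) ^ p := by
        refine lintegral_congr fun x => lintegral_congr fun v => ?_
        have hv : 0 < 1 + ‖v‖ := by positivity
        simp only [W]
        rw [← ENNReal.ofReal_mul (by positivity), ← ofReal_norm,
          ← ENNReal.ofReal_mul (by positivity),
          ENNReal.ofReal_rpow_of_nonneg (by positivity) hp0.le, mul_assoc (Real.exp _),
          ← Real.rpow_add_one hv.ne', Real.mul_rpow (by positivity) (by positivity),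
          Real.mul_rpow (by positivity) (by positivity), ← Real.exp_mul,
          ← Real.rpow_mul hv.le, Real.norm_eq_abs]
        ring_nf
    _ ≤ ENNReal.ofReal (2 / c + 2 * Metric.diam Ω) ^ p *
          ∫⁻ x in Ω, ∫⁻ v, (W v * ∫⁻ w, ‖k v w * h x w‖ₑ) ^ p :=
        lintegral_SOmK_rpow_le hΩo.measurableSet Metric.diam_nonneg
          (fun x hx y hy => Metric.dist_le_diam_of_mem hΩb hx hy) hp1 hc0 hc
          (nu_nonneg hB₀ γ) hmeas hh hW
    _ ≤ ENNReal.ofReal (2 / c + 2 * Metric.diam Ω) ^ p * ∫⁻ x in Ω, M ^ p *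
          ∫⁻ v, ENNReal.ofReal
            (|h x v| ^ p * Real.exp (p * α * ‖v‖ ^ 2) * (1 + ‖v‖) ^ (p * β₁)) := by
        refine mul_le_mul_right (lintegral_mono fun x => ?_) _
        exact lintegral_weight_mul_kernel_rpow_le hp1 hmeas h1 h2 hh.of_uncurry_left
    _ = T * ∫⁻ x in Ω, ∫⁻ v, ENNReal.ofReal
          (|h x v| ^ p * Real.exp (p * α * ‖v‖ ^ 2) * (1 + ‖v‖) ^ (p * β₁)) := by
        rw [lintegral_const_mul' _ _ (ENNReal.rpow_ne_top_of_nonneg hp0.le hM.ne), mul_assoc]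
    _ ≤ _ := mul_le_mul_left hTC _
end
end

section
/- Let −3 < γ ≤ 1, α ≥ 0, β₂ ∈ ℝ, and 2 ≤ p₁ < ∞ with p₁/(p₁ − 1) ≥ min{3, 3/|γ|} (with the convention min{3, 3/|γ|} = 3 when γ = 0). Let 1 ≤ q < min{3, 3/|γ|} and define p₂ by 1 + 1/p₂ = 1/q + 1/p₁ (which satisfies p₁ ≤ p₂ < ∞). Let k : ℝ³ × ℝ³ → ℝ be a measurable kernel such that the conjugated kernel k_α(v, v_*) := e^{α|v|²} k(v, v_*) e^{−α|v_*|²} satisfies, for some constants C₀ > 0 and α₁, α₂, α₃ > 0 and all v ≠ v_*, both |k_α(v, v_*)| ≤ C₀ w_γ(|v − v_*|) (1 + |v| + |v_*|)^{γ−1} e^{−α₁ |v − v_*|²} e^{−α₃ ((v − v_*)·v/|v − v_*| − α₂ |v − v_*|)²} and |k_α(v, v_*)| ≤ C₀ w_γ(|v − v_*|) (1 + |v| + |v_*|)^{γ−1} e^{−α₁ |v − v_*|²} e^{−α₃ ((v − v_*)·v_*/|v − v_*| + α₂ |v − v_*|)²}. Set β₄ = β₂ + 1 − γ + 1/q. Then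 there exists a constant C > 0 such that for every measurable h : ℝ³ → ℝ, ( ∫_{ℝ³} |∫_{ℝ³} k(v, v_*) h(v_*) dv_*|^{p₂} e^{p₂ α |v|²} (1 + |v|)^{p₂ β₄} dv )^{1/p₂} ≤ C ( ∫_{ℝ³} |h(v_*)|^{p₁} e^{p₁ α |v_*|²} (1 + |v_*|)^{p₁ β₂} dv_* )^{1/p₁}. -/
open MeasureTheory Real Set
open scoped ENNReal RealInnerProductSpace

noncomputable section

/-- `min {3, 3/|γ|}`, with the convention that it equals `3` when `γ = 0`. -/
def minExp (γ : ℝ) : ℝ := if γ = 0 then 3 else min 3 (3 / |γ|)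

/-- Young's inequality for integral kernels (Schur test with exponents). -/
theorem lintegral_kernel_young {X Y : Type*} [MeasurableSpace X] [MeasurableSpace Y]
    {μ : Measure X} {ν : Measure Y} [SFinite μ] [SFinite ν] {p q r : ℝ}
    (hp : 0 < p) (hq : 0 < q) (hr : 0 < r) (hpr : p ≤ r) (hqr : q ≤ r)
    (hpqr : 1 + 1 / r = 1 / q + 1 / p)
    {K : X → Y → ℝ≥0∞} (hK : Measurable (Function.uncurry K))
    {g : Y → ℝ≥0∞} (hg : Measurable g) {A : ℝ≥0∞}
    (hrow : ∀ x, ∫⁻ y, K x y ^ q ∂ν ≤ A) (hcol : ∀ y, ∫⁻ x, K x y ^ q ∂μ ≤ A) :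
    (∫⁻ x, (∫⁻ y, K x y * g y ∂ν) ^ r ∂μ) ^ (1 / r) ≤
      A ^ (1 / q) * (∫⁻ y, g y ^ p ∂ν) ^ (1 / p) := by
  set G := ∫⁻ y, g y ^ p ∂ν with hG
  have hb : 0 ≤ 1 / q - 1 / r := sub_nonneg.2 (one_div_le_one_div_of_le hq hqr)
  have hc : 0 ≤ 1 / p - 1 / r := sub_nonneg.2 (one_div_le_one_div_of_le hp hpr)
  have hKx : ∀ x, Measurable (K x) := fun x => hK.comp measurable_prodMk_left
  have pointwise : ∀ x, (∫⁻ y, K x y * g y ∂ν) ^ r ≤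
      (∫⁻ y, K x y ^ q * g y ^ p ∂ν) * (A ^ (r * (1 / q - 1 / r)) * G ^ (r * (1 / p - 1 / r))) := by
    intro x
    have key := ENNReal.lintegral_prod_norm_pow_le (μ := ν) Finset.univ
      (f := ![fun y => K x y ^ q * g y ^ p, fun y => K x y ^ q, fun y => g y ^ p])
      (p := ![1 / r, 1 / q - 1 / r, 1 / p - 1 / r])
      (by
        have h1 := (hKx x).pow_const q
        have h2 := hg.pow_const p
        intro i _
        fin_cases i
        · exact (h1.mul h2).aemeasurable
        · exact h1.aemeasurable
        · exact h2.aemeasurable)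
      (by simp only [Fin.sum_univ_three, Matrix.cons_val]; linarith)
      (by
        intro i _
        fin_cases i
        · exact (one_div_pos.2 hr).le
        · exact hb
        · exact hc)
    simp only [Fin.prod_univ_three, Matrix.cons_val] at key
    have hpt : ∀ y, K x y * g y = (K x y ^ q * g y ^ p) ^ (1 / r) *
        (K x y ^ q) ^ (1 / q - 1 / r) * (g y ^ p) ^ (1 / p - 1 / r) := by
      intro y
      have e1 : (K x y ^ q) ^ (1 / r) * (K x y ^ q) ^ (1 / q - 1 / r) = K x y := by
        rw [← ENNReal.rpow_add_of_nonneg _ _ (by positivity) hb, ← ENNReal.rpow_mul]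
        convert ENNReal.rpow_one _ using 2
        field_simp
        ring
      have e2 : (g y ^ p) ^ (1 / r) * (g y ^ p) ^ (1 / p - 1 / r) = g y := by
        rw [← ENNReal.rpow_add_of_nonneg _ _ (by positivity) hc, ← ENNReal.rpow_mul]
        convert ENNReal.rpow_one _ using 2
        field_simp
        ring
      rw [ENNReal.mul_rpow_of_nonneg _ _ (by positivity)]
      conv_lhs => rw [← e1, ← e2]
      ring
    simp_rw [hpt]
    calc _ ≤ _ := ENNReal.rpow_le_rpow key hr.le
      _ = (∫⁻ y, K x y ^ q * g y ^ p ∂ν) * ((∫⁻ y, K x y ^ q ∂ν) ^ (r * (1 / q - 1 / r)) *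
          G ^ (r * (1 / p - 1 / r))) := by
        rw [ENNReal.mul_rpow_of_nonneg _ _ hr.le, ENNReal.mul_rpow_of_nonneg _ _ hr.le,
          ← ENNReal.rpow_mul, ← ENNReal.rpow_mul, ← ENNReal.rpow_mul, one_div_mul_cancel hr.ne',
          ENNReal.rpow_one, mul_assoc, mul_comm r, mul_comm r]
      _ ≤ _ := by
        gcongr
        exact hrow x
  have swap : ∫⁻ x, ∫⁻ y, K x y ^ q * g y ^ p ∂ν ∂μ ≤ A * G := by
    rw [lintegral_lintegral_swap
      (((hK.pow_const q).mul ((hg.comp measurable_snd).pow_const p)).aemeasurable),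
      hG, ← lintegral_const_mul _ (hg.pow_const p)]
    refine lintegral_mono fun y => ?_
    have hKy : Measurable fun x => K x y ^ q :=
      (hK.comp (measurable_id.prodMk measurable_const)).pow_const q
    rw [lintegral_mul_const _ hKy]
    gcongr
    exact hcol y
  have hm : Measurable fun x => ∫⁻ y, K x y ^ q * g y ^ p ∂ν :=
    ((hK.pow_const q).mul ((hg.comp measurable_snd).pow_const p)).lintegral_prod_right'
  have hfin : ∫⁻ x, (∫⁻ y, K x y * g y ∂ν) ^ r ∂μ ≤ A ^ (r / q) * G ^ (r / p) := by
    calc _ ≤ _ := lintegral_mono pointwise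
      _ = _ := lintegral_mul_const _ hm
      _ ≤ A * G * (A ^ (r * (1 / q - 1 / r)) * G ^ (r * (1 / p - 1 / r))) := by gcongr
      _ = (A ^ (1 : ℝ) * A ^ (r * (1 / q - 1 / r))) *
          (G ^ (1 : ℝ) * G ^ (r * (1 / p - 1 / r))) := by
        rw [ENNReal.rpow_one, ENNReal.rpow_one]; ring
      _ = _ := by
        rw [← ENNReal.rpow_add_of_nonneg _ _ zero_le_one (by positivity),
          ← ENNReal.rpow_add_of_nonneg _ _ zero_le_one (by positivity)]
        congr 2 <;> · field_simp; ring
  calc _ ≤ (A ^ (r / q) * G ^ (r / p)) ^ (1 / r) := ENNReal.rpow_le_rpow hfin (by positivity)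
    _ = _ := by
      rw [ENNReal.mul_rpow_of_nonneg _ _ (by positivity), ← ENNReal.rpow_mul, ← ENNReal.rpow_mul]
      congr 2 <;> field_simp

/-- A Gaussian in `m cos θ + d`, integrated against `sin θ dθ`, decays like `1 / (1 + m)`. -/
theorem lintegral_sin_mul_gaussian_cos_le {c m : ℝ} (hc : 0 < c) (hm : 0 ≤ m) (d : ℝ) :
    ∫⁻ θ in Ioo 0 π, ENNReal.ofReal (sin θ) *
        ENNReal.ofReal (exp (-c * (m * cos θ + d) ^ 2)) ≤
      ENNReal.ofReal ((2 + √(π / c)) / (1 + m)) := by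
  set f : ℝ → ℝ := fun s => exp (-c * (m * s + d) ^ 2) with hf
  have step : ∫⁻ θ in Ioo 0 π, ENNReal.ofReal (sin θ) *
        ENNReal.ofReal (exp (-c * (m * cos θ + d) ^ 2)) ≤
      ∫⁻ s in Icc (-1) 1, ENNReal.ofReal (f s) := by
    have h := lintegral_image_eq_lintegral_abs_deriv_mul (s := Ioo 0 π) measurableSet_Ioo
      (fun x _ => (hasDerivAt_cos x).hasDerivWithinAt)
      (injOn_cos.mono Ioo_subset_Icc_self) (fun s => ENNReal.ofReal (f s))
    calc _ = ∫⁻ θ in Ioo 0 π, ENNReal.ofReal |-sin θ| * ENNReal.ofReal (f (cos θ)) := by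
          refine setLIntegral_congr_fun measurableSet_Ioo fun θ hθ => ?_
          simp only [hf]
          rw [abs_neg, abs_of_pos (sin_pos_of_mem_Ioo hθ)]
      _ = _ := h.symm
      _ ≤ _ := by
          refine lintegral_mono_set ?_
          rintro _ ⟨θ, -, rfl⟩
          exact cos_mem_Icc θ
  refine step.trans ?_
  have bound_two : ∫⁻ s in Icc (-1) 1, ENNReal.ofReal (f s) ≤ ENNReal.ofReal 2 := by
    calc _ ≤ ∫⁻ s in Icc (-1 : ℝ) 1, 1 := by
          refine lintegral_mono fun s => ENNReal.ofReal_le_one.2 (exp_le_one_iff.2 ?_)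
          have := mul_nonneg hc.le (sq_nonneg (m * s + d))
          linarith
      _ = _ := by
          rw [setLIntegral_one, Real.volume_Icc]
          norm_num
  rcases hm.eq_or_lt with rfl | hm
  · refine bound_two.trans (ENNReal.ofReal_le_ofReal ?_)
    have := sqrt_nonneg (π / c)
    linarith
  have gauss : ∫⁻ s in Icc (-1) 1, ENNReal.ofReal (f s) ≤ ENNReal.ofReal (√(π / c) / m) := by
    have hint : Integrable f := by
      have h0 : Integrable fun s : ℝ => exp (-c * s ^ 2) := integrable_exp_neg_mul_sq hc
      exact (h0.comp_add_right d).comp_mul_left' hm.ne'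
    calc _ ≤ ∫⁻ s, ENNReal.ofReal (f s) := setLIntegral_le_lintegral _ _
      _ = ENNReal.ofReal (∫ s, f s) :=
          (ofReal_integral_eq_lintegral_ofReal hint (ae_of_all _ fun s => (exp_pos _).le)).symm
      _ = _ := by
          congr 1
          have h1 := Measure.integral_comp_mul_left (fun x : ℝ => exp (-c * (x + d) ^ 2)) m
          have h2 := integral_add_right_eq_self (μ := volume) (fun x : ℝ => exp (-c * x ^ 2)) d
          rw [integral_gaussian] at h2
          rw [hf, h1, h2, abs_of_pos (inv_pos.2 hm), smul_eq_mul]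
          ring
  rw [← ENNReal.ofReal_toReal (ne_top_of_le_ne_top ENNReal.ofReal_ne_top bound_two)] at *
  set I := (∫⁻ s in Icc (-1) 1, ENNReal.ofReal (f s)).toReal
  rw [ENNReal.ofReal_le_ofReal_iff (by positivity)] at *
  rw [le_div_iff₀ hm] at gauss
  rw [le_div_iff₀ (by positivity)]
  linarith

/-- Polar coordinates in the plane, as an iterated integral. -/
theorem lintegral_polar_prod {F : ℝ × ℝ → ℝ≥0∞} (hF : Measurable F) :
    ∫⁻ z, F z = ∫⁻ r in Ioi (0 : ℝ), ENNReal.ofReal r *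
      ∫⁻ θ in Ioo (-π) π, F (r * cos θ, r * sin θ) := by
  have hm : Measurable fun p : ℝ × ℝ => F (p.1 * cos p.2, p.1 * sin p.2) :=
    hF.comp (by fun_prop)
  rw [← lintegral_comp_polarCoord_symm, polarCoord_target, Measure.volume_eq_prod,
    ← Measure.prod_restrict, lintegral_prod _ (by
      simp only [polarCoord_symm_apply, smul_eq_mul]; fun_prop)]
  refine lintegral_congr fun r => ?_
  simp only [polarCoord_symm_apply, smul_eq_mul]
  rw [lintegral_const_mul]
  exact hm.comp measurable_prodMk_left

theorem measurePreserving_E3_prod :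
    MeasurePreserving (fun u : E3 => (u 0, (u 1, u 2))) volume volume := by
  have h1 := EuclideanSpace.volume_preserving_symm_measurableEquiv_toLp (Fin 3)
  have h2 := volume_preserving_piFinSuccAbove (fun _ : Fin 3 => ℝ) 0
  have h3 := (MeasurePreserving.id (volume : Measure ℝ)).prod (volume_preserving_finTwoArrow ℝ)
  exact h3.comp (h2.comp h1)

/-- Spherical coordinates for functions of the first coordinate and the norm. -/
theorem lintegral_E3_spherical {Ξ : ℝ → ℝ → ℝ≥0∞} (hΞ : Measurable (Function.uncurry Ξ)) :
    ∫⁻ u : E3, Ξ (u 0) ‖u‖ = ENNReal.ofReal (2 * π) * ∫⁻ r in Ioi (0 : ℝ), ENNReal.ofReal (r ^ 2) *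
      ∫⁻ θ in Ioo 0 π, ENNReal.ofReal (sin θ) * Ξ (r * cos θ) r := by
  have hF : Measurable fun z : ℝ × ℝ × ℝ => Ξ z.1 √(z.1 ^ 2 + (z.2.1 ^ 2 + z.2.2 ^ 2)) :=
    hΞ.comp (f := fun z : ℝ × ℝ × ℝ => (z.1, √(z.1 ^ 2 + (z.2.1 ^ 2 + z.2.2 ^ 2)))) (by fun_prop)
  have hG : Measurable fun z : ℝ × ℝ => Ξ z.1 √(z.1 ^ 2 + z.2 ^ 2) :=
    hΞ.comp (f := fun z : ℝ × ℝ => (z.1, √(z.1 ^ 2 + z.2 ^ 2))) (by fun_prop)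
  have hnorm : ∀ u : E3, ‖u‖ = √(u 0 ^ 2 + (u 1 ^ 2 + u 2 ^ 2)) := fun u => by
    rw [EuclideanSpace.norm_eq, Fin.sum_univ_three]
    simp [add_assoc]
  have plane : ∀ x : ℝ, ∫⁻ z : ℝ × ℝ, Ξ x √(x ^ 2 + (z.1 ^ 2 + z.2 ^ 2)) =
      ENNReal.ofReal (2 * π) *
        ∫⁻ ρ in Ioi (0 : ℝ), ENNReal.ofReal ρ * Ξ x √(x ^ 2 + ρ ^ 2) := by
    intro x
    rw [lintegral_polar_prod (F := fun z : ℝ × ℝ => Ξ x √(x ^ 2 + (z.1 ^ 2 + z.2 ^ 2)))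
      (hF.comp measurable_prodMk_left), ← lintegral_const_mul' _ _ ENNReal.ofReal_ne_top]
    refine lintegral_congr fun ρ => ?_
    have : ∀ θ, (ρ * cos θ) ^ 2 + (ρ * sin θ) ^ 2 = ρ ^ 2 := fun θ => by
      linear_combination ρ ^ 2 * sin_sq_add_cos_sq θ
    simp only [this, lintegral_const, Measure.restrict_apply_univ, Real.volume_Ioo]
    rw [show π - -π = 2 * π by ring]
    ring
  have hI : Measurable fun z : ℝ × ℝ =>
      (Ioi (0 : ℝ)).indicator (fun ρ => ENNReal.ofReal ρ * Ξ z.1 √(z.1 ^ 2 + ρ ^ 2)) z.2 := by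
    have : Measurable fun z : ℝ × ℝ => ENNReal.ofReal z.2 * Ξ z.1 √(z.1 ^ 2 + z.2 ^ 2) :=
      (by fun_prop : Measurable fun z : ℝ × ℝ => ENNReal.ofReal z.2).mul hG
    exact this.indicator (measurable_snd measurableSet_Ioi)
  calc ∫⁻ u : E3, Ξ (u 0) ‖u‖
      = ∫⁻ z : ℝ × ℝ × ℝ, Ξ z.1 √(z.1 ^ 2 + (z.2.1 ^ 2 + z.2.2 ^ 2)) := by
        rw [← measurePreserving_E3_prod.lintegral_comp hF]
        simp only [hnorm]
    _ = ∫⁻ x, ∫⁻ z : ℝ × ℝ, Ξ x √(x ^ 2 + (z.1 ^ 2 + z.2 ^ 2)) :=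
        lintegral_prod _ hF.aemeasurable
    _ = ENNReal.ofReal (2 * π) *
        ∫⁻ x, ∫⁻ ρ in Ioi (0 : ℝ), ENNReal.ofReal ρ * Ξ x √(x ^ 2 + ρ ^ 2) := by
        simp only [plane]
        exact lintegral_const_mul' _ _ ENNReal.ofReal_ne_top
    _ = ENNReal.ofReal (2 * π) * ∫⁻ z : ℝ × ℝ,
        (Ioi (0 : ℝ)).indicator (fun ρ => ENNReal.ofReal ρ * Ξ z.1 √(z.1 ^ 2 + ρ ^ 2)) z.2 := by
        rw [Measure.volume_eq_prod, lintegral_prod _ hI.aemeasurable]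
        simp only [lintegral_indicator measurableSet_Ioi]
    _ = _ := by
        rw [lintegral_polar_prod hI]
        congr 1
        refine setLIntegral_congr_fun measurableSet_Ioi fun r hr => ?_
        have hr : 0 < r := hr
        have hsub : Ioo 0 π ⊆ Ioo (-π) π := Ioo_subset_Ioo_left (by linarith [pi_pos])
        have hval : ∀ θ, √((r * cos θ) ^ 2 + (r * sin θ) ^ 2) = r := fun θ => by
          rw [show (r * cos θ) ^ 2 + (r * sin θ) ^ 2 = r ^ 2 by
            linear_combination r ^ 2 * sin_sq_add_cos_sq θ, sqrt_sq hr.le]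
        have hin : ∫⁻ θ in Ioo (-π) π, (Ioi (0 : ℝ)).indicator (fun ρ => ENNReal.ofReal ρ *
              Ξ (r * cos θ) √((r * cos θ) ^ 2 + ρ ^ 2)) (r * sin θ) =
            ∫⁻ θ in Ioo 0 π, ENNReal.ofReal r * (ENNReal.ofReal (sin θ) * Ξ (r * cos θ) r) := by
          rw [← lintegral_indicator measurableSet_Ioo, ← lintegral_indicator measurableSet_Ioo]
          refine lintegral_congr fun θ => ?_
          by_cases hθ : θ ∈ Ioo 0 π
          · have hs : r * sin θ ∈ Ioi (0 : ℝ) := mul_pos hr (sin_pos_of_mem_Ioo hθ)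
            rw [indicator_of_mem hθ, indicator_of_mem (hsub hθ)]
            simp only [indicator_of_mem hs, hval, ENNReal.ofReal_mul hr.le, mul_assoc]
          · rw [indicator_of_notMem hθ]
            refine indicator_apply_eq_zero.2 fun h => indicator_of_notMem ?_ _
            have hle : θ ≤ 0 := by
              by_contra! h0
              exact hθ ⟨h0, h.2⟩
            exact not_lt.2 (mul_nonpos_of_nonneg_of_nonpos hr.le
              (sin_nonpos_of_nonpos_of_neg_pi_le hle h.1.le))
        simp only [hin]
        rw [lintegral_const_mul' _ _ ENNReal.ofReal_ne_top, ← mul_assoc, ← ENNReal.ofReal_mul hr.le,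
          sq]

theorem exists_isometry_inner_eq (v : E3) :
    ∃ R : E3 ≃ₗᵢ[ℝ] E3, ∀ u, ⟪R u, v⟫ = ‖v‖ * u 0 := by
  set e : E3 := EuclideanSpace.single 0 (1 : ℝ) with he
  have hn : ‖v‖ = ‖‖v‖ • e‖ := by simp [he, norm_smul]
  refine ⟨(Submodule.span ℝ {v - ‖v‖ • e})ᗮ.reflection, fun u => ?_⟩
  rw [← LinearIsometryEquiv.inner_map_map (Submodule.span ℝ {v - ‖v‖ • e})ᗮ.reflection,
    Submodule.reflection_reflection, Submodule.reflection_sub hn]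
  simp [he, inner_smul_right, EuclideanSpace.inner_single_right]

/-- A radial function times a Gaussian in the angular variable `⟪u, v⟫ / ‖u‖` gains a factor
`1 / (1 + ‖v‖)` after integration. -/
theorem lintegral_radial_mul_gaussian_inner_le {c : ℝ} (hc : 0 < c) (b : ℝ) {Φ : ℝ → ℝ≥0∞}
    (hΦ : Measurable Φ) (v : E3) :
    ∫⁻ u : E3, Φ ‖u‖ * ENNReal.ofReal (exp (-c * (⟪u, v⟫ / ‖u‖ + b * ‖u‖) ^ 2)) ≤
      ENNReal.ofReal ((2 + √(π / c)) / (1 + ‖v‖)) *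
        (ENNReal.ofReal (2 * π) * ∫⁻ r in Ioi (0 : ℝ), ENNReal.ofReal (r ^ 2) * Φ r) := by
  obtain ⟨R, hR⟩ := exists_isometry_inner_eq v
  set Ξ : ℝ → ℝ → ℝ≥0∞ := fun x r =>
    Φ r * ENNReal.ofReal (exp (-c * (‖v‖ * x / r + b * r) ^ 2)) with hΞ
  have hm : Measurable (Function.uncurry Ξ) :=
    (hΦ.comp measurable_snd).mul
      (by fun_prop : Measurable fun z : ℝ × ℝ =>
        ENNReal.ofReal (exp (-c * (‖v‖ * z.1 / z.2 + b * z.2) ^ 2)))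
  have rot : ∫⁻ u : E3, Φ ‖u‖ * ENNReal.ofReal (exp (-c * (⟪u, v⟫ / ‖u‖ + b * ‖u‖) ^ 2)) =
      ∫⁻ u : E3, Ξ (u 0) ‖u‖ := by
    rw [← R.measurePreserving.lintegral_comp_emb R.toMeasurableEquiv.measurableEmbedding]
    simp only [hR, LinearIsometryEquiv.norm_map, hΞ]
  rw [rot, lintegral_E3_spherical hm, mul_left_comm]
  gcongr ENNReal.ofReal (2 * π) * ?_
  rw [← lintegral_const_mul' _ _ ENNReal.ofReal_ne_top]
  refine setLIntegral_mono' measurableSet_Ioi fun r hr => ?_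
  have hr : 0 < r := hr
  have hang : ∀ θ, ENNReal.ofReal (sin θ) * Ξ (r * cos θ) r =
      Φ r * (ENNReal.ofReal (sin θ) *
        ENNReal.ofReal (exp (-c * (‖v‖ * cos θ + b * r) ^ 2))) := fun θ => by
    simp only [hΞ]
    rw [show ‖v‖ * (r * cos θ) / r = ‖v‖ * cos θ by field_simp]
    ring
  simp only [hang]
  rw [lintegral_const_mul _ (by fun_prop)]
  calc _ ≤ ENNReal.ofReal (r ^ 2) *
        (Φ r * ENNReal.ofReal ((2 + √(π / c)) / (1 + ‖v‖))) := by
        gcongr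
        exact lintegral_sin_mul_gaussian_cos_le hc (norm_nonneg v) _
    _ = _ := by ring

theorem lintegral_rpow_gaussian_lt_top {s M c : ℝ} (hs : -1 < s) (hM : 0 ≤ M) (hc : 0 < c) :
    ∫⁻ r in Ioi (0 : ℝ), ENNReal.ofReal (r ^ s * (1 + r) ^ M * exp (-c * r ^ 2)) < ∞ := by
  have hint := (integrableOn_rpow_mul_exp_neg_mul_sq (half_pos hc) hs).const_mul
    (exp (M ^ 2 / (2 * c)))
  refine lt_of_le_of_lt (setLIntegral_mono' measurableSet_Ioi fun r hr => ?_)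
    hint.lintegral_lt_top
  have hr : 0 < r := hr
  refine ENNReal.ofReal_le_ofReal ?_
  have h1 : (1 + r) ^ M ≤ exp (M * r) := by
    rw [mul_comm, exp_mul]
    exact rpow_le_rpow (by positivity) (by linarith [add_one_le_exp r]) hM
  have h2 : M * r - c * r ^ 2 ≤ M ^ 2 / (2 * c) - c / 2 * r ^ 2 := by
    have : M ^ 2 / (2 * c) - c / 2 * r ^ 2 - (M * r - c * r ^ 2) = (M - c * r) ^ 2 / (2 * c) := by
      field_simp
      ring
    have h3 : 0 ≤ (M - c * r) ^ 2 / (2 * c) := by positivity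
    linarith
  calc _ ≤ r ^ s * exp (M * r) * exp (-c * r ^ 2) := by gcongr
    _ = r ^ s * exp (M * r - c * r ^ 2) := by
      rw [mul_assoc, ← exp_add]; ring_nf
    _ ≤ r ^ s * exp (M ^ 2 / (2 * c) - c / 2 * r ^ 2) := by gcongr
    _ = _ := by
      rw [sub_eq_add_neg, exp_add]; ring_nf

/-- Peetre's inequality for real powers. -/
theorem one_add_rpow_mul_rpow_neg_le {x y r : ℝ} (hx : 0 ≤ x) (hy : 0 ≤ y) (hr : 0 ≤ r)
    (hxy : x ≤ y + r) (hyx : y ≤ x + r) (β : ℝ) :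
    (1 + x) ^ β * (1 + y) ^ (-β) ≤ (1 + r) ^ |β| := by
  have key : ∀ {a b β : ℝ}, 0 ≤ a → 0 ≤ b → a ≤ b + r → 0 ≤ β →
      (1 + a) ^ β * (1 + b) ^ (-β) ≤ (1 + r) ^ β := by
    intro a b β ha hb hab hβ
    rw [rpow_neg (by positivity), ← div_eq_mul_inv, div_le_iff₀ (by positivity),
      ← mul_rpow (by positivity) (by positivity)]
    refine rpow_le_rpow (by positivity) ?_ hβ
    nlinarith [mul_nonneg hr hb]
  rcases le_total 0 β with h | h
  · rw [abs_of_nonneg h]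
    exact key hx hy hxy h
  · rw [abs_of_nonpos h, mul_comm]
    simpa using key hy hx hyx (neg_nonneg.2 h)

/-- Weight comparison with the remaining power `s` put on the first variable. -/
theorem weight_le_left {x y r : ℝ} (hx : 0 ≤ x) (hy : 0 ≤ y) (hr : 0 ≤ r)
    (hxy : x ≤ y + r) (hyx : y ≤ x + r) {γ s : ℝ} (hγ : γ ≤ 1) (hs : 0 ≤ s) (β : ℝ) :
    (1 + x) ^ (β + 1 - γ + s) * (1 + x + y) ^ (γ - 1) * (1 + y) ^ (-β) ≤
      (1 + x) ^ s * (1 + r) ^ (|β| + s) := by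
  have h1 : (1 + x + y) ^ (γ - 1) ≤ (1 + x) ^ (γ - 1) :=
    rpow_le_rpow_of_nonpos (by positivity) (by linarith) (by linarith)
  calc _ ≤ (1 + x) ^ (β + 1 - γ + s) * (1 + x) ^ (γ - 1) * (1 + y) ^ (-β) := by gcongr
    _ = (1 + x) ^ s * ((1 + x) ^ β * (1 + y) ^ (-β)) := by
      rw [← rpow_add (by positivity), ← mul_assoc, ← rpow_add (by positivity)]
      ring_nf
    _ ≤ (1 + x) ^ s * (1 + r) ^ |β| := by
      gcongr
      exact one_add_rpow_mul_rpow_neg_le hx hy hr hxy hyx β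
    _ ≤ _ := by
      gcongr <;> linarith

/-- Weight comparison with the remaining power `s` put on the second variable. -/
theorem weight_le_right {x y r : ℝ} (hx : 0 ≤ x) (hy : 0 ≤ y) (hr : 0 ≤ r)
    (hxy : x ≤ y + r) (hyx : y ≤ x + r) {γ s : ℝ} (hγ : γ ≤ 1) (hs : 0 ≤ s) (β : ℝ) :
    (1 + x) ^ (β + 1 - γ + s) * (1 + x + y) ^ (γ - 1) * (1 + y) ^ (-β) ≤
      (1 + y) ^ s * (1 + r) ^ (|β| + s) := by
  have h1 : (1 + x + y) ^ (γ - 1) ≤ (1 + x) ^ (γ - 1) :=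
    rpow_le_rpow_of_nonpos (by positivity) (by linarith) (by linarith)
  calc _ ≤ (1 + x) ^ (β + 1 - γ + s) * (1 + x) ^ (γ - 1) * (1 + y) ^ (-β) := by gcongr
    _ = (1 + y) ^ s * ((1 + x) ^ (β + s) * (1 + y) ^ (-(β + s))) := by
      rw [← rpow_add (by positivity), mul_left_comm, ← rpow_add (by positivity)]
      ring_nf
    _ ≤ (1 + y) ^ s * (1 + r) ^ |β + s| := by
      gcongr
      exact one_add_rpow_mul_rpow_neg_le hx hy hr hxy hyx _
    _ ≤ _ := by
      gcongr
      · linarith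
      · exact (abs_add_le β s).trans_eq (by rw [abs_of_nonneg hs])

/-- The radial profile dominating the weighted conjugated kernel. -/
def radialBound (C₀ a N α₁ r : ℝ) : ℝ :=
  C₀ * (1 / r ^ a) * (1 + r) ^ N * exp (-α₁ * r ^ 2)

theorem lintegral_radialBound_rpow_lt_top {C₀ a N α₁ q : ℝ} (hC₀ : 0 < C₀) (hN : 0 ≤ N)
    (hα₁ : 0 < α₁) (hq : 0 < q) (haq : a * q < 3) :
    ∫⁻ r in Ioi (0 : ℝ), ENNReal.ofReal (r ^ 2) * ENNReal.ofReal (radialBound C₀ a N α₁ r) ^ q <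
      ∞ := by
  have hfin := lintegral_rpow_gaussian_lt_top (s := 2 - a * q) (M := N * q) (c := α₁ * q)
    (by linarith) (by positivity) (by positivity)
  have heq : ∀ r ∈ Ioi (0 : ℝ),
      ENNReal.ofReal (r ^ 2) * ENNReal.ofReal (radialBound C₀ a N α₁ r) ^ q =
      ENNReal.ofReal (C₀ ^ q) *
        ENNReal.ofReal (r ^ (2 - a * q) * (1 + r) ^ (N * q) * exp (-(α₁ * q) * r ^ 2)) := by
    intro r hr
    have hr : 0 < r := hr
    rw [radialBound, ENNReal.ofReal_rpow_of_nonneg (by positivity) hq.le,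
      ← ENNReal.ofReal_mul (by positivity), ← ENNReal.ofReal_mul (by positivity),
      mul_rpow (by positivity) (by positivity), mul_rpow (by positivity) (by positivity),
      mul_rpow (by positivity) (by positivity), ← rpow_mul (by positivity), ← exp_mul,
      one_div, ← rpow_neg hr.le, ← rpow_mul hr.le, sub_eq_add_neg, rpow_add hr,
      rpow_two]
    ring_nf
  rw [setLIntegral_congr_fun measurableSet_Ioi heq,
    lintegral_const_mul' _ _ ENNReal.ofReal_ne_top]
  exact ENNReal.mul_lt_top ENNReal.ofReal_lt_top hfin

theorem ofReal_weighted_kernel_rpow_le {C₀ a N α₁ α₃ q r t B P W W' Z : ℝ} (hC₀ : 0 ≤ C₀)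
    (hr : 0 ≤ r) (hq : 0 < q) (hZ : 0 ≤ Z) (hW : 0 ≤ W) (hW' : 0 ≤ W')
    (hB : B ≤ C₀ * (1 / r ^ a) * P * exp (-α₁ * r ^ 2) * exp (-α₃ * t ^ 2))
    (hweight : W * P * W' ≤ Z ^ (1 / q) * (1 + r) ^ N) :
    ENNReal.ofReal (W * B * W') ^ q ≤ ENNReal.ofReal Z *
      (ENNReal.ofReal (radialBound C₀ a N α₁ r) ^ q *
        ENNReal.ofReal (exp (-(α₃ * q) * t ^ 2))) := by
  have hle : W * B * W' ≤ Z ^ (1 / q) * (radialBound C₀ a N α₁ r * exp (-α₃ * t ^ 2)) := by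
    calc _ ≤ W * (C₀ * (1 / r ^ a) * P * exp (-α₁ * r ^ 2) * exp (-α₃ * t ^ 2)) * W' := by gcongr
      _ = (C₀ * (1 / r ^ a) * exp (-α₁ * r ^ 2) * exp (-α₃ * t ^ 2)) * (W * P * W') := by ring
      _ ≤ (C₀ * (1 / r ^ a) * exp (-α₁ * r ^ 2) * exp (-α₃ * t ^ 2)) *
          (Z ^ (1 / q) * (1 + r) ^ N) := by gcongr
      _ = _ := by rw [radialBound]; ring
  have hM : 0 ≤ radialBound C₀ a N α₁ r := by unfold radialBound; positivity
  calc _ ≤ _ := ENNReal.rpow_le_rpow (ENNReal.ofReal_le_ofReal hle) hq.le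
    _ = _ := by
      rw [ENNReal.ofReal_mul (by positivity), ENNReal.ofReal_mul hM,
        ENNReal.mul_rpow_of_nonneg _ _ hq.le, ENNReal.mul_rpow_of_nonneg _ _ hq.le,
        ENNReal.ofReal_rpow_of_nonneg (by positivity) hq.le, ← rpow_mul hZ,
        one_div_mul_cancel hq.ne', rpow_one,
        ENNReal.ofReal_rpow_of_nonneg (exp_pos _).le hq.le, ← exp_mul]
      ring_nf

theorem ofReal_one_add_norm_mul_div (v : E3) {D : ℝ} :
    ENNReal.ofReal (1 + ‖v‖) * ENNReal.ofReal (D / (1 + ‖v‖)) = ENNReal.ofReal D := by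
  have : 0 < 1 + ‖v‖ := by positivity
  rw [← ENNReal.ofReal_mul this.le, mul_div_cancel₀ _ this.ne']

theorem lt_neg_one_of_minExp_le_two {γ : ℝ} (hγ : γ ≤ 1) (h : minExp γ ≤ 2) : γ < -1 := by
  by_contra! hge
  unfold minExp at h
  split_ifs at h with h0
  · norm_num at h
  · have h1 : |γ| ≤ 1 := abs_le.2 ⟨hge, hγ⟩
    have h2 : 3 ≤ 3 / |γ| := by
      rw [le_div_iff₀ (abs_pos.2 h0)]
      linarith
    rw [min_eq_left h2] at h
    norm_num at h

/-- Young-type `L^{p₁}_v → L^{p₂}_v` regularization of the integral operator `K` in the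
case `p₁' ≥ min{3, 3/|γ|}`, with `1 + 1/p₂ = 1/q + 1/p₁` and `β₄ = β₂ + 1 − γ + 1/q`. -/
theorem K_Lp1_to_Lp2_velocity (γ α β₂ p₁ q p₂ C₀ α₁ α₂ α₃ : ℝ)
    (hγl : -3 < γ) (hγu : γ ≤ 1) (hα : 0 ≤ α) (hp₁ : 2 ≤ p₁)
    (hp₁' : minExp γ ≤ p₁ / (p₁ - 1))
    (hq1 : 1 ≤ q) (hq2 : q < minExp γ)
    (hp₂ : 1 + 1 / p₂ = 1 / q + 1 / p₁)
    (hC₀ : 0 < C₀) (hα₁ : 0 < α₁) (hα₂ : 0 < α₂) (hα₃ : 0 < α₃)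
    (k : E3 → E3 → ℝ) (hmeas : Measurable (Function.uncurry k))
    (hb1 : ∀ v vs : E3, v ≠ vs →
      |Real.exp (α * ‖v‖ ^ 2) * k v vs * Real.exp (-α * ‖vs‖ ^ 2)| ≤
        C₀ * wGamma γ ‖v - vs‖ * (1 + ‖v‖ + ‖vs‖) ^ (γ - 1) *
          Real.exp (-α₁ * ‖v - vs‖ ^ 2) *
          Real.exp (-α₃ * (⟪v - vs, v⟫ / ‖v - vs‖ - α₂ * ‖v - vs‖) ^ 2))
    (hb2 : ∀ v vs : E3, v ≠ vs →
      |Real.exp (α * ‖v‖ ^ 2) * k v vs * Real.exp (-α * ‖vs‖ ^ 2)| ≤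
        C₀ * wGamma γ ‖v - vs‖ * (1 + ‖v‖ + ‖vs‖) ^ (γ - 1) *
          Real.exp (-α₁ * ‖v - vs‖ ^ 2) *
          Real.exp (-α₃ * (⟪v - vs, vs⟫ / ‖v - vs‖ + α₂ * ‖v - vs‖) ^ 2)) :
    ∃ C > (0 : ℝ), ∀ h : E3 → ℝ, Measurable h →
      (∫⁻ v : E3, ENNReal.ofReal
          (|∫ vs : E3, k v vs * h vs| ^ p₂ * Real.exp (p₂ * α * ‖v‖ ^ 2) *
            (1 + ‖v‖) ^ (p₂ * (β₂ + 1 - γ + 1 / q)))) ^ (1 / p₂) ≤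
        ENNReal.ofReal C *
          (∫⁻ vs : E3, ENNReal.ofReal
            (|h vs| ^ p₁ * Real.exp (p₁ * α * ‖vs‖ ^ 2) *
              (1 + ‖vs‖) ^ (p₁ * β₂))) ^ (1 / p₁) := by
  have hmin2 : minExp γ ≤ 2 := hp₁'.trans (by rw [div_le_iff₀ (by linarith)]; linarith)
  have hγ1 : γ < -1 := lt_neg_one_of_minExp_le_two hγu hmin2
  have hq : 0 < q := by linarith
  have hp : 0 < p₁ := by linarith
  have hw : ∀ r, wGamma γ r = 1 / r ^ |γ| := fun r => by
    rw [wGamma, if_neg (by linarith), if_neg (by linarith)]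
  have haq : |γ| * q < 3 := by
    have h1 : q < 3 / |γ| := by
      rw [minExp, if_neg (by linarith)] at hq2
      exact hq2.trans_le (min_le_right _ _)
    rw [lt_div_iff₀ (abs_pos.2 (by linarith))] at h1
    linarith
  have hr_inv : 0 < 1 / p₂ := by
    have h1 : q < p₁ / (p₁ - 1) := hq2.trans_le hp₁'
    have h2 := one_div_lt_one_div_of_lt hq h1
    have h3 : 1 / (p₁ / (p₁ - 1)) = 1 - 1 / p₁ := by field_simp
    linarith
  have hr : 0 < p₂ := one_div_pos.1 hr_inv
  have hp_inv : 1 / p₁ ≤ 1 := (div_le_one hp).2 (by linarith)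
  have hq_inv : 1 / q ≤ 1 := (div_le_one hq).2 hq1
  have hpr : p₁ ≤ p₂ := (one_div_le_one_div hr hp).1 (by linarith)
  have hqr : q ≤ p₂ := (one_div_le_one_div hr hq).1 (by linarith)
  set N := |β₂| + 1 / q
  set β₄ := β₂ + 1 - γ + 1 / q
  set Φ : ℝ → ℝ≥0∞ := fun r => ENNReal.ofReal (radialBound C₀ |γ| N α₁ r) ^ q with hΦ
  have hΦm : Measurable Φ := by
    simp only [hΦ, radialBound]
    fun_prop
  set I := ENNReal.ofReal (2 * π) * ∫⁻ r in Ioi (0 : ℝ), ENNReal.ofReal (r ^ 2) * Φ r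
  have hIfin : I < ∞ := ENNReal.mul_lt_top ENNReal.ofReal_lt_top
    (lintegral_radialBound_rpow_lt_top hC₀ (by positivity) hα₁ hq haq)
  set A := ENNReal.ofReal (2 + √(π / (α₃ * q))) * I
  have hAfin : A < ∞ := ENNReal.mul_lt_top ENNReal.ofReal_lt_top hIfin
  have hc : 0 < α₃ * q := by positivity
  set K : E3 → E3 → ℝ≥0∞ := fun v w => ENNReal.ofReal ((1 + ‖v‖) ^ β₄ *
    |exp (α * ‖v‖ ^ 2) * k v w * exp (-α * ‖w‖ ^ 2)| * (1 + ‖w‖) ^ (-β₂)) with hK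
  have hKm : Measurable (Function.uncurry K) := by
    have hk : Measurable fun z : E3 × E3 => k z.1 z.2 := hmeas
    simp only [hK, Function.uncurry_def]
    fun_prop
  have htri : ∀ v w : E3, ‖v‖ ≤ ‖w‖ + ‖v - w‖ ∧ ‖w‖ ≤ ‖v‖ + ‖v - w‖ := fun v w =>
    ⟨norm_le_norm_add_norm_sub' v w, norm_le_norm_add_norm_sub v w⟩
  have hrow : ∀ v, ∫⁻ w, K v w ^ q ≤ A := by
    intro v
    set F : E3 → ℝ≥0∞ := fun u =>
      Φ ‖u‖ * ENNReal.ofReal (exp (-(α₃ * q) * (⟪u, v⟫ / ‖u‖ + -α₂ * ‖u‖) ^ 2))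
    have hle : ∀ᵐ w : E3, K v w ^ q ≤ ENNReal.ofReal (1 + ‖v‖) * F (v - w) := by
      filter_upwards [(countable_singleton v).ae_notMem volume] with w hvw
      have hb := hb1 v w fun h => hvw h.symm
      rw [hw, sub_eq_add_neg (⟪v - w, v⟫ / ‖v - w‖), ← neg_mul α₂] at hb
      exact ofReal_weighted_kernel_rpow_le hC₀.le (norm_nonneg _) hq (by positivity)
        (by positivity) (by positivity) hb
        (weight_le_left (norm_nonneg v) (norm_nonneg w) (norm_nonneg _) (htri v w).1 (htri v w).2
          hγu (by positivity) β₂)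
    calc _ ≤ _ := lintegral_mono_ae hle
      _ = ENNReal.ofReal (1 + ‖v‖) * ∫⁻ u, F u := by
        rw [lintegral_const_mul' _ _ ENNReal.ofReal_ne_top, lintegral_sub_left_eq_self F v]
      _ ≤ ENNReal.ofReal (1 + ‖v‖) *
          (ENNReal.ofReal ((2 + √(π / (α₃ * q))) / (1 + ‖v‖)) * I) := by
        gcongr
        exact lintegral_radial_mul_gaussian_inner_le hc (-α₂) hΦm v
      _ = A := by rw [← mul_assoc, ofReal_one_add_norm_mul_div]
  have hcol : ∀ w, ∫⁻ v, K v w ^ q ≤ A := by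
    intro w
    set F : E3 → ℝ≥0∞ := fun u =>
      Φ ‖u‖ * ENNReal.ofReal (exp (-(α₃ * q) * (⟪u, w⟫ / ‖u‖ + α₂ * ‖u‖) ^ 2))
    have hle : ∀ᵐ v : E3, K v w ^ q ≤ ENNReal.ofReal (1 + ‖w‖) * F (v - w) := by
      filter_upwards [(countable_singleton w).ae_notMem volume] with v hvw
      have hb := hb2 v w hvw
      rw [hw] at hb
      exact ofReal_weighted_kernel_rpow_le hC₀.le (norm_nonneg _) hq (by positivity)
        (by positivity) (by positivity) hb
        (weight_le_right (norm_nonneg v) (norm_nonneg w) (norm_nonneg _) (htri v w).1 (htri v w).2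
          hγu (by positivity) β₂)
    calc _ ≤ _ := lintegral_mono_ae hle
      _ = ENNReal.ofReal (1 + ‖w‖) * ∫⁻ u, F u := by
        rw [lintegral_const_mul' _ _ ENNReal.ofReal_ne_top, lintegral_sub_right_eq_self F w]
      _ ≤ ENNReal.ofReal (1 + ‖w‖) *
          (ENNReal.ofReal ((2 + √(π / (α₃ * q))) / (1 + ‖w‖)) * I) := by
        gcongr
        exact lintegral_radial_mul_gaussian_inner_le hc α₂ hΦm w
      _ = A := by rw [← mul_assoc, ofReal_one_add_norm_mul_div]
  have hAq : A ^ (1 / q) ≠ ∞ := ENNReal.rpow_ne_top_of_nonneg (by positivity) hAfin.ne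
  refine ⟨(A ^ (1 / q)).toReal + 1, by positivity, fun h hh => ?_⟩
  set g : E3 → ℝ≥0∞ := fun w =>
    ENNReal.ofReal (|h w| * exp (α * ‖w‖ ^ 2) * (1 + ‖w‖) ^ β₂) with hg
  have hgm : Measurable g := by
    simp only [hg]
    fun_prop
  have hprod : ∀ v w, K v w * g w =
      ENNReal.ofReal (exp (α * ‖v‖ ^ 2) * (1 + ‖v‖) ^ β₄) * ‖k v w * h w‖ₑ := by
    intro v w
    have h1 : exp (-α * ‖w‖ ^ 2) * exp (α * ‖w‖ ^ 2) = 1 := by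
      rw [← exp_add]; simp
    have h2 : (1 + ‖w‖) ^ (-β₂) * (1 + ‖w‖) ^ β₂ = 1 := by
      rw [← rpow_add (by positivity)]; simp
    simp only [hK, hg]
    rw [Real.enorm_eq_ofReal_abs, ← ENNReal.ofReal_mul (by positivity),
      ← ENNReal.ofReal_mul (by positivity), abs_mul, abs_mul, abs_mul, abs_exp, abs_exp]
    congr 1
    linear_combination (1 + ‖v‖) ^ β₄ * exp (α * ‖v‖ ^ 2) * |k v w| * |h w| *
      ((1 + ‖w‖) ^ (-β₂) * (1 + ‖w‖) ^ β₂ * h1 + h2)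
  have hleft : ∀ v, ENNReal.ofReal (|∫ w, k v w * h w| ^ p₂ * exp (p₂ * α * ‖v‖ ^ 2) *
      (1 + ‖v‖) ^ (p₂ * β₄)) ≤ (∫⁻ w, K v w * g w) ^ p₂ := by
    intro v
    have e : |∫ w, k v w * h w| ^ p₂ * exp (p₂ * α * ‖v‖ ^ 2) * (1 + ‖v‖) ^ (p₂ * β₄) =
        (exp (α * ‖v‖ ^ 2) * (1 + ‖v‖) ^ β₄ * |∫ w, k v w * h w|) ^ p₂ := by
      rw [mul_rpow (by positivity) (by positivity), mul_rpow (by positivity) (by positivity),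
        ← exp_mul, ← rpow_mul (by positivity)]
      ring_nf
    rw [e, ← ENNReal.ofReal_rpow_of_nonneg (by positivity) hr.le]
    refine ENNReal.rpow_le_rpow ?_ hr.le
    simp only [hprod]
    rw [lintegral_const_mul' _ _ ENNReal.ofReal_ne_top, ENNReal.ofReal_mul (by positivity),
      ← Real.enorm_eq_ofReal_abs]
    gcongr
    exact enorm_integral_le_lintegral_enorm _
  have hright : ∀ w, g w ^ p₁ = ENNReal.ofReal (|h w| ^ p₁ * exp (p₁ * α * ‖w‖ ^ 2) *
      (1 + ‖w‖) ^ (p₁ * β₂)) := by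
    intro w
    simp only [hg]
    rw [ENNReal.ofReal_rpow_of_nonneg (by positivity) hp.le,
      mul_rpow (by positivity) (by positivity), mul_rpow (by positivity) (by positivity),
      ← exp_mul, ← rpow_mul (by positivity)]
    ring_nf
  calc _ ≤ (∫⁻ v, (∫⁻ w, K v w * g w) ^ p₂) ^ (1 / p₂) :=
        ENNReal.rpow_le_rpow (lintegral_mono hleft) hr_inv.le
    _ ≤ A ^ (1 / q) * (∫⁻ w, g w ^ p₁) ^ (1 / p₁) :=
        lintegral_kernel_young hp hq hr hpr hqr hp₂ hKm hgm hrow hcol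
    _ ≤ _ := by
        simp only [hright]
        gcongr
        calc A ^ (1 / q) = ENNReal.ofReal (A ^ (1 / q)).toReal := (ENNReal.ofReal_toReal hAq).symm
          _ ≤ _ := ENNReal.ofReal_le_ofReal (by linarith)
end
end
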